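/- arXiv:0912.1559 — 2 statements merged into one kernel-verified Lean document; each statement's English description precedes it below -/
import Mathlib

section
/- Let R be a CG-ring, L ≤ R^× a subgroup, T a pure L-orbit on R, and S a nonempty subset of T. Then for every unit character χ ∈ R̂^× there exists r ∈ R^× such that Σ_{s∈S} χ(rs) ≠ 0. -/
open Pointwise

/-- A Galois ring: a finite commutative local ring whose radical is `pR` for a prime `p`. -/
def IsGaloisRing (R : Type*) [CommRing R] : Prop :=
  ∃ p : ℕ, p.Prime ∧ IsLocalRing R ∧ nilradical R = Ideal.span {(p : R)}

/-- A CG-ring: a finite commutative ring isomorphic to a product of Galois rings of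
pairwise coprime characteristics. -/
def IsCGRing (R : Type*) [CommRing R] : Prop :=
  ∃ (n : ℕ) (S : Fin n → Type) (instR : ∀ i, CommRing (S i)) (_ : ∀ i, Fintype (S i)),
    letI : ∀ i, CommRing (S i) := instR
    (∀ i, IsGaloisRing (S i)) ∧
    (∀ i j, i ≠ j → Nat.Coprime (ringChar (S i)) (ringChar (S j))) ∧
    Nonempty (R ≃+* ∀ i, S i)

/-- A nonempty subset `X` of a ring is pure if `X + I = X` forces `I = 0`. -/
def IsPureSet {R : Type*} [CommRing R] (X : Set R) : Prop :=
  ∀ I : Ideal R, X + (I : Set R) = X → I = ⊥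


lemma aux_sum {R : Type*} [CommRing R] {ι : Type*} (χ : AddChar R ℂ) (J : Finset ι)
    (f : ι → R) : χ (∑ i ∈ J, f i) = ∏ i ∈ J, χ (f i) := by
  classical
  induction J using Finset.induction_on with
  | empty => simp
  | insert a s ha ih =>
    rw [Finset.sum_insert ha, Finset.prod_insert ha, AddChar.map_add_eq_mul, ih]

lemma aux_fourier {R : Type*} [CommRing R] [Fintype R] {ι : Type*} [Fintype ι] [DecidableEq ι]
    (χ : AddChar R ℂ) (hχ : χ.IsPrimitive) (S : Finset R) (s : R) (hs : s ∈ S) (a : ι → R)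
    (ha : ∀ r : R, ¬ IsUnit r → ∃ i, r * a i = 0)
    (hJ : ∀ J : Finset ι, J.Nonempty → s + ∑ i ∈ J, a i ∉ S) :
    ∃ r : Rˣ, ∑ x ∈ S, χ ((r : R) * x) ≠ 0 := by
  classical
  by_contra! hcon
  have h1 : ∑ r : R, (∑ x ∈ S, χ (r * x)) * χ (-(r * s)) * ∏ i, (1 + -χ (-(r * a i))) = 0 := by
    refine Finset.sum_eq_zero fun r _ => ?_
    by_cases hr : IsUnit r
    · obtain ⟨u, rfl⟩ := hr
      rw [hcon u]; simp
    · obtain ⟨i, hi⟩ := ha r hr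
      rw [Finset.prod_eq_zero (Finset.mem_univ i)]
      · simp
      · simp [hi]
  have h2 : ∀ r : R, (∑ x ∈ S, χ (r * x)) * χ (-(r * s)) * ∏ i, (1 + -χ (-(r * a i)))
      = ∑ J : Finset ι, (-1) ^ J.card * ∑ x ∈ S, χ (r * (x - (s + ∑ i ∈ J, a i))) := by
    intro r
    rw [Finset.prod_one_add, Finset.mul_sum, Finset.powerset_univ]
    refine Finset.sum_congr rfl fun J _ => ?_
    have : ∏ i ∈ J, -χ (-(r * a i)) = (-1) ^ J.card * χ (-(r * ∑ i ∈ J, a i)) := by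
      rw [Finset.prod_neg, Finset.mul_sum, ← Finset.sum_neg_distrib, aux_sum]
    rw [this, Finset.sum_mul, Finset.sum_mul, Finset.mul_sum (s := S)]
    refine Finset.sum_congr rfl fun x _ => ?_
    have : r * (x - (s + ∑ i ∈ J, a i)) = r * x + -(r * s) + -(r * ∑ i ∈ J, a i) := by ring
    rw [this, AddChar.map_add_eq_mul, AddChar.map_add_eq_mul]
    ring
  simp_rw [h2] at h1
  rw [Finset.sum_comm] at h1
  simp_rw [← Finset.mul_sum] at h1
  have h3 : ∀ J : Finset ι, ∑ r : R, ∑ x ∈ S, χ (r * (x - (s + ∑ i ∈ J, a i)))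
      = if s + ∑ i ∈ J, a i ∈ S then (Fintype.card R : ℂ) else 0 := by
    intro J
    rw [Finset.sum_comm]
    simp_rw [AddChar.sum_mulShift _ hχ, sub_eq_zero]
    push_cast
    rw [Finset.sum_ite_eq']
  simp_rw [h3] at h1
  rw [Finset.sum_eq_single ∅] at h1
  · simp [hs] at h1
  · intro J _ hne
    rw [if_neg (hJ J (Finset.nonempty_iff_ne_empty.mpr hne))]; simp
  · simp

lemma aux_local {A : Type*} [CommRing A] [Finite A] [IsLocalRing A] :
    ∃ I : Ideal A, I ≠ ⊥ ∧ (∀ r : A, ¬ IsUnit r → ∀ b ∈ I, r * b = 0) ∧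
      ∀ x : A, (∃ b ∈ I, ∀ l : A, IsUnit l → l * x ≠ x + b) ∨
        (∀ l : A, l * x - x ∈ I → ∀ b ∈ I, (l - 1) * b = 0) := by
  have hnil : ∃ k, IsLocalRing.maximalIdeal A ^ k = ⊥ := by
    obtain ⟨k, hk⟩ := IsArtinianRing.isNilpotent_jacobson_bot (R := A)
    rw [IsLocalRing.jacobson_eq_maximalIdeal ⊥ bot_ne_top] at hk
    exact ⟨k, hk⟩
  have hI : ∃ I : Ideal A, I ≠ ⊥ ∧ (∀ r : A, ¬ IsUnit r → ∀ b ∈ I, r * b = 0) := by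
    classical
    have hk := Nat.find_spec hnil
    have hmin := fun m => Nat.find_min (m := m) hnil
    rcases hkk : Nat.find hnil with _ | k
    · rw [hkk] at hk
      simp at hk
    · rw [hkk] at hk
      refine ⟨IsLocalRing.maximalIdeal A ^ k, hmin k (by omega), fun r hr b hb => ?_⟩
      have : r * b ∈ IsLocalRing.maximalIdeal A ^ (k + 1) := by
        rw [pow_succ']
        exact Ideal.mul_mem_mul ((IsLocalRing.mem_maximalIdeal r).mpr hr) hb
      rw [hk] at this
      simpa using this
  obtain ⟨I, h0, h1⟩ := hI
  refine ⟨I, h0, h1, fun x => ?_⟩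
  by_cases hx : x ∈ I
  · left
    by_cases hx0 : x = 0
    · obtain ⟨b, hb, hb0⟩ := Submodule.exists_mem_ne_zero_of_ne_bot h0
      exact ⟨b, hb, fun l _ h => hb0 (by simpa [hx0] using h.symm)⟩
    · refine ⟨-x, I.neg_mem hx, fun l hl h => hx0 ?_⟩
      rw [add_neg_cancel] at h
      exact (hl.mul_right_eq_zero).mp h
  · right
    intro l hl
    refine h1 (l - 1) fun hu => hx ?_
    have : (l - 1) * x ∈ I := by rwa [sub_mul, one_mul]
    exact (Ideal.unit_mul_mem_iff_mem I hu).mp this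

lemma aux_pow {A : Type*} [CommRing A] (l x c : A) (h : l * x = x + c) (hc : (l - 1) * c = 0)
    (m : ℕ) : l ^ m * x = x + m * c := by
  induction m with
  | zero => simp
  | succ m ih =>
    rw [pow_succ', mul_assoc, ih]
    push_cast
    linear_combination h + (m : A) * hc

/-- Separation theorem, part 2: if `S` is a nonempty subset of a pure orbit `T` of a
subgroup `L ≤ R^×` on a CG-ring `R`, then for every unit character `χ = χ₀(u·)` there
is a unit `r` with `χ(rS) ≠ 0`. -/
theorem nonvanishing_on_unit_multiple {R : Type*} [CommRing R] [Fintype R]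
    (hCG : IsCGRing R) (L : Subgroup Rˣ)
    (χ₀ : AddChar R ℂ) (hχ₀ : Function.Bijective (fun r : R => χ₀.mulShift r))
    (T : Set R) (t : R) (hT : T = {y : R | ∃ l ∈ L, ((l : Rˣ) : R) * t = y})
    (hTpure : IsPureSet T)
    (S : Set R) (hS : S ⊆ T) (hSne : S.Nonempty) :
    ∀ u : Rˣ, ∃ r : Rˣ, (∑ᶠ s ∈ S, χ₀ ((u : R) * ((r : R) * s))) ≠ 0 := by
  classical
  intro u
  obtain ⟨n, A, instR, instF, hG, hcop, ⟨e⟩⟩ := hCG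
  choose p hp hloc hnil using hG
  have hprim : χ₀.IsPrimitive := by
    intro r hr h
    apply hr
    apply hχ₀.1
    simp only [h, AddChar.mulShift_zero]
  have hpnil : ∀ i, IsNilpotent ((p i : ℕ) : A i) := fun i => by
    rw [← mem_nilradical, hnil i]
    exact Ideal.mem_span_singleton_self _
  have hpchar : ∀ i, p i ∣ ringChar (A i) := by
    intro i
    obtain ⟨N, hN⟩ := hpnil i
    have h1 : ringChar (A i) ∣ p i ^ N := ringChar.dvd (by push_cast; exact hN)
    obtain ⟨k, _, hk⟩ := (Nat.dvd_prime_pow (hp i)).mp h1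
    rcases k with _ | k
    · have := hloc i
      exact absurd (by simpa using hk) (CharP.ringChar_ne_one (R := A i))
    · rw [hk]; exact dvd_pow_self _ (by omega)
  have hpcop : ∀ i j, i ≠ j → Nat.Coprime (p i) (p j) := fun i j hij =>
    Nat.Coprime.of_dvd (hpchar i) (hpchar j) (hcop i j hij)
  have hex := fun i => @aux_local (A i) _ _ (hloc i)
  choose I hI0 hIr hIx using hex
  have hpI : ∀ i, ∀ b ∈ I i, ((p i : ℕ) : A i) * b = 0 := by
    intro i
    apply hIr
    intro hu
    have := hloc i
    exact (hpnil i).not_isUnit hu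
  obtain ⟨s, hs⟩ := hSne
  -- the orbit of `s` is `T`
  have hsT := hS hs
  have hmul : ∀ l ∈ L, ∀ y ∈ T, ((l : Rˣ) : R) * y ∈ T := by
    intro l hl y hy
    rw [hT] at hy ⊢
    obtain ⟨l', hl', rfl⟩ := hy
    exact ⟨l * l', L.mul_mem hl hl', by push_cast; ring⟩
  have hrep : ∀ y ∈ T, ∃ l ∈ L, ((l : Rˣ) : R) * s = y := by
    intro y hy
    rw [hT] at hy hsT
    obtain ⟨l, hl, rfl⟩ := hy
    obtain ⟨l', hl', h⟩ := hsT
    refine ⟨l * l'⁻¹, L.mul_mem hl (L.inv_mem hl'), ?_⟩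
    rw [← h]
    push_cast
    rw [mul_assoc, Units.inv_mul_cancel_left]
  have hpure : ∀ i, ∃ b ∈ I i, s + e.symm (Pi.single i b) ∉ T := by
    intro i
    let K : Ideal R :=
      { carrier := {x | e x i ∈ I i ∧ ∀ j, j ≠ i → e x j = 0}
        add_mem' := by
          rintro x y ⟨hx, hx'⟩ ⟨hy, hy'⟩
          refine ⟨by rw [map_add]; exact (I i).add_mem hx hy, fun j hj => ?_⟩
          rw [map_add, Pi.add_apply, hx' j hj, hy' j hj, add_zero]
        zero_mem' := by simp
        smul_mem' := by
          rintro c x ⟨hx, hx'⟩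
          refine ⟨by rw [smul_eq_mul, map_mul]; exact (I i).mul_mem_left _ hx, fun j hj => ?_⟩
          rw [smul_eq_mul, map_mul, Pi.mul_apply, hx' j hj, mul_zero] }
    by_contra! hcon
    have hK : K = ⊥ := by
      apply hTpure
      apply Set.Subset.antisymm
      · rintro _ ⟨y, hy, k, hk, rfl⟩
        obtain ⟨l, hl, rfl⟩ := hrep y hy
        have hk2 : ((l⁻¹ : Rˣ) : R) * k ∈ K := K.mul_mem_left _ hk
        have h2 := hcon _ hk2.1
        have h3 : e.symm (Pi.single i (e (((l⁻¹ : Rˣ) : R) * k) i)) = ((l⁻¹ : Rˣ) : R) * k := by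
          rw [RingEquiv.symm_apply_eq]
          funext j
          by_cases hj : j = i
          · subst hj; simp
          · rw [Pi.single_eq_of_ne hj, hk2.2 j hj]
        rw [h3] at h2
        have h4 := hmul l hl _ h2
        rwa [mul_add, Units.mul_inv_cancel_left] at h4
      · intro y hy
        exact ⟨y, hy, 0, K.zero_mem, add_zero y⟩
    obtain ⟨b, hb, hb0⟩ := Submodule.exists_mem_ne_zero_of_ne_bot (hI0 i)
    have hbK : e.symm (Pi.single i b) ∈ K := by
      refine ⟨by simpa using hb, fun j hj => ?_⟩
      rw [RingEquiv.apply_symm_apply, Pi.single_eq_of_ne hj]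
    rw [hK, Ideal.mem_bot, map_eq_zero_iff e.symm e.symm.injective] at hbK
    exact hb0 (by simpa using congrFun hbK i)
  have hb : ∀ i, ∃ b ∈ I i, (∀ l : A i, IsUnit l → l * e s i ≠ e s i + b) ∨
      ((∀ l : A i, l * e s i - e s i ∈ I i → ∀ b ∈ I i, (l - 1) * b = 0) ∧
        s + e.symm (Pi.single i b) ∉ T) := by
    intro i
    rcases hIx i (e s i) with ⟨b, hb, h⟩ | h
    · exact ⟨b, hb, Or.inl h⟩
    · obtain ⟨b, hb, h'⟩ := hpure i
      exact ⟨b, hb, Or.inr ⟨h, h'⟩⟩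
  choose b hbI hb using hb
  have hfin : S.Finite := Set.toFinite S
  have key := aux_fourier χ₀ hprim hfin.toFinset s (by simpa using hs)
    (fun i => e.symm (Pi.single i (b i))) ?_ ?_
  · obtain ⟨r, hr⟩ := key
    refine ⟨u⁻¹ * r, ?_⟩
    rw [finsum_mem_eq_finite_toFinset_sum _ hfin]
    convert hr using 3
    push_cast
    rw [mul_assoc, Units.mul_inv_cancel_left]
  · intro r hr
    have : ∃ i, ¬ IsUnit (e r i) := by
      by_contra! h
      exact hr ((MulEquiv.isUnit_map e).mp (Pi.isUnit_iff.mpr h))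
    obtain ⟨i, hi⟩ := this
    refine ⟨i, e.injective ?_⟩
    rw [map_mul, RingEquiv.apply_symm_apply, map_zero]
    funext j
    by_cases hj : j = i
    · subst hj
      simpa using hIr j _ hi _ (hbI j)
    · simp [Pi.single_eq_of_ne hj]
  · rintro J ⟨i, hi⟩ hmem
    obtain ⟨l, hl, hls⟩ := hrep _ (hS (by simpa using hmem))
    have hcoord : ∀ j, e (l : R) j * e s j = e s j + if j ∈ J then b j else 0 := by
      intro j
      have := congrFun (congrArg e hls) j
      rw [map_mul, map_add, map_sum, Pi.mul_apply, Pi.add_apply, Finset.sum_apply] at this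
      rw [this]
      congr 1
      simp only [RingEquiv.apply_symm_apply]
      by_cases hj : j ∈ J
      · rw [if_pos hj, Finset.sum_eq_single_of_mem j hj, Pi.single_eq_same]
        intro k _ hk
        exact Pi.single_eq_of_ne hk.symm _
      · rw [if_neg hj]
        refine Finset.sum_eq_zero fun k hk => Pi.single_eq_of_ne ?_ _
        rintro rfl
        exact hj hk
    have hlu : ∀ j, IsUnit (e (l : R) j) := fun j =>
      Pi.isUnit_iff.mp ((MulEquiv.isUnit_map e).mpr l.isUnit) j
    have hP : ∀ j ∈ J, ((∀ l : A j, l * e s j - e s j ∈ I j → ∀ b ∈ I j, (l - 1) * b = 0) ∧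
        s + e.symm (Pi.single j (b j)) ∉ T) := by
      intro j hj
      refine (hb j).resolve_left fun h => h _ (hlu j) ?_
      rw [hcoord j, if_pos hj]
    have hcoI : ∀ j, (if j ∈ J then b j else 0) ∈ I j := by
      intro j
      split_ifs
      · exact hbI j
      · exact (I j).zero_mem
    obtain ⟨m, hm1, hm2⟩ : ∃ m : ℕ, m ≡ 1 [MOD p i] ∧ m ≡ 0 [MOD ∏ j ∈ Finset.univ.erase i, p j] := by
      have hc : Nat.Coprime (p i) (∏ j ∈ Finset.univ.erase i, p j) :=
        Nat.Coprime.prod_right fun j hj => hpcop i j (Finset.ne_of_mem_erase hj).symm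
      exact ⟨_, (Nat.chineseRemainder hc 1 0).2⟩
    have hpow : ∀ j, e (l : R) j ^ m * e s j = e s j + m * if j ∈ J then b j else 0 := by
      intro j
      refine aux_pow _ _ _ (hcoord j) ?_ m
      by_cases hj : j ∈ J
      · refine (hP j hj).1 _ ?_ _ (hcoI j)
        rw [hcoord j, add_sub_cancel_left]
        exact hcoI j
      · simp [hj]
    apply (hP i hi).2
    have hfinal : ((l ^ m : Rˣ) : R) * s = s + e.symm (Pi.single i (b i)) := by
      apply e.injective
      funext j
      rw [map_mul, map_add, RingEquiv.apply_symm_apply, Pi.mul_apply, Pi.add_apply,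
        Units.val_pow_eq_pow_val, map_pow, Pi.pow_apply, hpow j]
      congr 1
      by_cases hj : j = i
      · subst hj
        rw [if_pos hi, Pi.single_eq_same]
        have hmpos : 1 ≤ m := by
          rcases Nat.eq_zero_or_pos m with h | h
          · subst h
            have := (Nat.modEq_zero_iff_dvd.mp hm1.symm)
            exact absurd (Nat.dvd_one.mp this) (hp j).one_lt.ne'
          · exact h
        obtain ⟨q, hq⟩ := (Nat.modEq_iff_dvd' hmpos).mp hm1.symm
        have : m = p j * q + 1 := by omega
        rw [this]
        push_cast
        linear_combination (q : A j) * hpI j _ (hbI j)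
      · rw [Pi.single_eq_of_ne hj]
        obtain ⟨q, hq⟩ := (Finset.dvd_prod_of_mem p
          (Finset.mem_erase.mpr ⟨hj, Finset.mem_univ j⟩)).trans (Nat.modEq_zero_iff_dvd.mp hm2)
        rw [hq]
        push_cast
        linear_combination (q : A j) * hpI j _ (hcoI j)
    rw [← hfinal]
    exact hmul _ (L.pow_mem hl m) s hsT
end

section
/- Let A be a pure S-ring over a CG-ring R. Then the dual S-ring Â over the dual ring R̂ is also pure. -/
open Pointwise

/-- A Schur ring over the additive group of `R`, given combinatorially by its
partition into basic sets with constant structure constants. -/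
structure AddSchurRing (R : Type*) [AddCommGroup R] where
  parts : Set (Set R)
  nonempty : ∀ X ∈ parts, X.Nonempty
  cover : ∀ g : R, ∃ X ∈ parts, g ∈ X
  disjoint : ∀ X ∈ parts, ∀ Y ∈ parts, X ≠ Y → X ∩ Y = ∅
  zero_mem : {0} ∈ parts
  neg_closed : ∀ X ∈ parts, -X ∈ parts
  struct_const : ∀ X ∈ parts, ∀ Y ∈ parts, ∀ Z ∈ parts, ∀ z₁ ∈ Z, ∀ z₂ ∈ Z,
    Set.ncard {xy : R × R | xy.1 ∈ X ∧ xy.2 ∈ Y ∧ xy.1 + xy.2 = z₁} =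
    Set.ncard {xy : R × R | xy.1 ∈ X ∧ xy.2 ∈ Y ∧ xy.1 + xy.2 = z₂}

/-- An S-ring over the ring `R`: an S-ring over `R⁺` invariant under multiplication
by units of `R`. -/
def AddSchurRing.IsRingSRing {R : Type*} [CommRing R] (A : AddSchurRing R) : Prop :=
  ∀ u : Rˣ, ∀ X ∈ A.parts, (fun x : R => (u : R) * x) '' X ∈ A.parts

/-- A subset of `R` is an `A`-set if it is a union of basic sets of `A`. -/
def AddSchurRing.IsASet {R : Type*} [AddCommGroup R] (A : AddSchurRing R) (S : Set R) :
    Prop :=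
  ∀ g ∈ S, ∃ X ∈ A.parts, g ∈ X ∧ X ⊆ S

/-- The partition of the additive character group dual to a family of subsets of `R`. -/
noncomputable def addDualParts {R : Type*} [AddCommGroup R] (parts : Set (Set R)) :
    Set (Set (AddChar R ℂ)) :=
  Set.range (fun ψ₀ : AddChar R ℂ =>
    {ψ : AddChar R ℂ | ∀ S ∈ parts, (∑ᶠ s ∈ S, ψ s) = ∑ᶠ s ∈ S, ψ₀ s})


def CGp (R : Type*) [CommRing R] : Prop :=
  ∀ q : ℕ, q.Prime → ∀ x : R, (q : R) ∣ x ∨ ∃ y, (q : R) ∣ x * y - 1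

structure QD {R : Type*} [CommRing R] (q : ℕ) (e : R) (k : ℕ) : Prop where
  idem : e * e = e
  kpos : 0 < k
  kill : (q : R) ^ k * e = 0
  ne : (q : R) ^ (k - 1) * e ≠ 0
  inv : ∃ t, (q : R) * t = 1 - e
  int : ∃ m : ℤ, e = m
  val : ∀ x, ∃ b : ℕ, ∃ u : Rˣ, (1 - e) * u = 1 - e ∧ e * x = (q : R) ^ b * e * u

lemma finite_exists_idem_pow {R : Type*} [CommRing R] [Finite R] (x : R) :
    ∃ N : ℕ, 0 < N ∧ x ^ N * x ^ N = x ^ N := by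
  obtain ⟨a, b, hab, h⟩ := Finite.exists_ne_map_eq_of_infinite (fun n : ℕ => x ^ n)
  wlog hlt : a < b generalizing a b
  · exact this b a hab.symm h.symm (lt_of_le_of_ne (not_lt.mp hlt) hab.symm)
  obtain ⟨d, hd⟩ := Nat.exists_eq_add_of_lt hlt
  -- x^(a + (d+1)) = x^a
  have h1 : ∀ m, x ^ (a + m * (d + 1)) = x ^ a := by
    intro m
    induction m with
    | zero => simp
    | succ m ih =>
      have : a + (m + 1) * (d + 1) = (a + m * (d + 1)) + (d + 1) := by ring
      rw [this, pow_add, ih, ← pow_add]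
      have h' : x ^ a = x ^ b := h
      rw [h', hd]; congr 1
  refine ⟨(a + 1) * (d + 1), by positivity, ?_⟩
  have h2 : (a + 1) * (d + 1) = a + (a * d + d + 1) := by ring
  rw [← pow_add]
  have : (a + 1) * (d + 1) + (a + 1) * (d + 1) = (a + (a + 1) * (d + 1)) + (a * d + d + 1) := by ring
  rw [this, pow_add, h1, ← pow_add, h2]

/-- nilpotent perturbation on the `e` part -/
lemma unit_of_nilp {R : Type*} [CommRing R] {q : ℕ} {e : R} {k : ℕ} (he : e * e = e)
    (hk : (q : R) ^ k * e = 0) (t : R) : ∃ u : Rˣ, (u : R) = 1 + q * e * t := by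
  have : IsNilpotent ((q : R) * e * t) := by
    refine ⟨k + 1, ?_⟩
    have h2 : e ^ (k + 1) = e := IsIdempotentElem.pow_succ_eq k he
    rw [mul_pow, mul_pow, h2, pow_succ, mul_right_comm ((q:R)^k), hk]; ring
  have h := this.isUnit_one_add
  exact ⟨h.unit, rfl⟩

lemma exists_QD {R : Type*} [CommRing R] [Finite R] (h : CGp R) (q : ℕ) (hq : q.Prime)
    (hu : ¬ IsUnit (q : R)) : ∃ e : R, ∃ k, QD q e k := by
  obtain ⟨N, hN, hid⟩ := finite_exists_idem_pow (q : R)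
  set e : R := 1 - (q : R) ^ N with he
  have hee : e * e = e := by rw [he]; linear_combination hid
  have hkill : ∃ k, (q : R) ^ k * e = 0 := ⟨N, by rw [he]; linear_combination -hid⟩
  have hne : e ≠ 0 := by
    intro h0
    apply hu
    have : (q : R) ^ N = 1 := by rw [he] at h0; linear_combination -h0
    exact IsUnit.of_pow_eq_one this hN.ne'
  classical
  have hk := Nat.find_spec hkill
  set k := Nat.find hkill with hkdef
  have hkpos : 0 < k := by
    rcases Nat.eq_zero_or_pos k with h0 | h0
    · rw [h0] at hk; simp at hk; exact absurd hk hne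
    · exact h0
  refine ⟨e, k, hee, hkpos, hk, Nat.find_min hkill (by omega), ?_, ?_, ?_⟩
  · refine ⟨(q : R) ^ (N - 1), ?_⟩
    rw [← pow_succ', Nat.sub_add_cancel hN, he]; ring
  · exact ⟨1 - (q : ℤ) ^ N, by push_cast; rfl⟩
  · intro x
    by_contra hcon
    push Not at hcon
    have key : ∀ j : ℕ, ∃ z, e * x = (q : R) ^ j * e * z := by
      intro j
      induction j with
      | zero => exact ⟨x, by simp⟩
      | succ j ih =>
        obtain ⟨z, hz⟩ := ih
        rcases h q hq z with ⟨w, hw⟩ | ⟨y, s, hs⟩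
        · exact ⟨w, by rw [hz, hw]; ring⟩
        · exfalso
          obtain ⟨v, hv⟩ := unit_of_nilp hee hk s
          -- z * e + (1-e) is a unit
          have hzu : (z * e + (1 - e)) * ((y * e + (1 - e)) * (v⁻¹ : Rˣ)) = 1 := by
            have : (z * e + (1 - e)) * (y * e + (1 - e)) = v := by
              rw [hv]; linear_combination e * hs + (z * y - z - y + 1) * hee
            rw [← mul_assoc, this]; simp
          refine hcon j (Units.mkOfMulEqOne _ _ hzu) ?_ ?_
          · simp only [Units.val_mkOfMulEqOne]; linear_combination (1 - z) * hee
          · simp only [Units.val_mkOfMulEqOne]; rw [hz]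
            linear_combination (1 - z) * (q:R)^j * hee
    obtain ⟨z, hz⟩ := key k
    refine hcon k 1 (by simp) ?_
    rw [hz, hk]; simp

namespace QD
variable {R : Type*} [CommRing R] {q : ℕ} {e : R} {k : ℕ}

lemma e_ne (H : QD q e k) : e ≠ 0 := by
  rintro rfl; exact H.ne (by simp)

lemma pow_ne (H : QD q e k) {b : ℕ} (hb : b < k) : (q : R) ^ b * e ≠ 0 := by
  intro h0
  apply H.ne
  have : k - 1 = (k - 1 - b) + b := by omega
  rw [this, pow_add, mul_assoc, h0, mul_zero]

lemma pow_zero (H : QD q e k) {b : ℕ} (hb : k ≤ b) : (q : R) ^ b * e = 0 := by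
  obtain ⟨c, rfl⟩ := Nat.exists_eq_add_of_le hb
  rw [pow_add, mul_right_comm, H.kill, zero_mul]

lemma lt_of_ne (H : QD q e k) {b : ℕ} (hb : (q : R) ^ b * e ≠ 0) : b < k := by
  by_contra h; exact hb (H.pow_zero (not_lt.mp h))

/-- killed by `q` lies in the `e` part. -/
lemma e_mul_of_kill (H : QD q e k) {w : R} (hw : (q : R) * w = 0) : e * w = w := by
  obtain ⟨t, ht⟩ := H.inv
  linear_combination w * ht - t * hw

lemma kill_form (H : QD q e k) {w : R} (hw : (q : R) * w = 0) (h0 : w ≠ 0) :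
    ∃ u : Rˣ, (1 - e) * u = 1 - e ∧ w = (q : R) ^ (k - 1) * e * u := by
  obtain ⟨b, u, hu, hb⟩ := H.val w
  rw [H.e_mul_of_kill hw] at hb
  have h1 : b < k := H.lt_of_ne (by rintro h; rw [h, zero_mul] at hb; exact h0 hb)
  have h2 : (q : R) ^ (b + 1) * e = 0 := by
    have : (q : R) ^ (b + 1) * e * u = 0 := by rw [← hw, hb]; ring
    simpa using this
  have h3 : k ≤ b + 1 := by
    by_contra h; exact H.pow_ne (not_le.mp h) h2
  have : b = k - 1 := by omega
  subst this
  exact ⟨u, hu, hb⟩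

lemma kill_form' (H : QD q e k) {w : R} (hw : (q : R) * w = 0) :
    ∃ t : R, w = (q : R) ^ (k - 1) * e * t := by
  by_cases h0 : w = 0
  · exact ⟨0, by simp [h0]⟩
  · obtain ⟨u, -, hu⟩ := H.kill_form hw h0
    exact ⟨u, hu⟩

lemma y_kill (H : QD q e k) : (q : R) * ((q : R) ^ (k - 1) * e) = 0 := by
  rw [← mul_assoc, ← pow_succ', Nat.sub_add_cancel H.kpos, H.kill]

lemma e_y (H : QD q e k) : e * ((q : R) ^ (k - 1) * e) = (q : R) ^ (k - 1) * e := by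
  linear_combination (q : R) ^ (k - 1) * H.idem

/-- Any ideal meeting the `e` part nontrivially contains `y`. -/
lemma y_mem (H : QD q e k) (I : Ideal R) {z : R} (hz : z ∈ I) (h0 : e * z ≠ 0) :
    (q : R) ^ (k - 1) * e ∈ I := by
  obtain ⟨b, u, hu, hb⟩ := H.val z
  have h1 : b < k := H.lt_of_ne (by rintro h; rw [h, zero_mul] at hb; exact h0 hb)
  have : (q : R) ^ (k - 1) * e = ((q : R) ^ (k - 1 - b) * (u⁻¹ : Rˣ) * e) * z := by
    have h2 : (q : R) ^ (k - 1) = (q : R) ^ (k - 1 - b) * (q : R) ^ b := by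
      rw [← pow_add]; congr 1; omega
    rw [mul_assoc _ e z, hb, h2]
    have : (u : R) * (u⁻¹ : Rˣ) = 1 := by simp
    linear_combination (-(q : R) ^ (k - 1 - b) * (q : R) ^ b * e) * this
  rw [this]
  exact I.mul_mem_left _ hz

/-- transitivity on cosets away from the socle -/
lemma coset_unit (H : QD q e k) {x w : R} (hx : (q : R) * (e * x) ≠ 0) (hw : (q : R) * w = 0) :
    ∃ v : Rˣ, (1 - e) * v = 1 - e ∧ x + w = v * x := by
  obtain ⟨b, u, hu, hb⟩ := H.val x
  obtain ⟨t, ht⟩ := H.kill_form' hw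
  have h1 : b + 1 < k := H.lt_of_ne (by
    intro h; apply hx; rw [hb]
    linear_combination (u : R) * h)
  obtain ⟨v, hv⟩ := unit_of_nilp H.idem H.kill ((q : R) ^ (k - 2 - b) * (u⁻¹ : Rˣ) * t)
  refine ⟨v, ?_, ?_⟩
  · rw [hv]; linear_combination (-(q : R) * ((q : R) ^ (k - 2 - b) * (u⁻¹ : Rˣ) * t)) * H.idem
  · have h2 : (q : R) ^ (k - 1) = (q : R) ^ (k - 2 - b) * (q : R) ^ b * q := by
      rw [← pow_add, ← pow_succ]; congr 1; omega
    have h3 : (u : R) * (u⁻¹ : Rˣ) = 1 := by simp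
    rw [hv, ht, h2]
    linear_combination (-(q : R) * ((q : R) ^ (k - 2 - b) * (u⁻¹ : Rˣ) * t)) * hb
      - (q : R) ^ (k - 2 - b) * (q : R) ^ b * q * e * t * h3

end QD

section ring
variable {R : Type*} [CommRing R] [Fintype R]

/-- The primes that are not invertible in `R`. -/
noncomputable def PP (R : Type*) [CommRing R] [Fintype R] : Finset ℕ := by
  classical exact (Fintype.card R).primeFactors.filter (fun q => ¬ IsUnit (q : R))

lemma mem_PP {q : ℕ} : q ∈ PP R ↔ q.Prime ∧ ¬ IsUnit (q : R) := by
  classical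
  unfold PP
  rw [Finset.mem_filter, Nat.mem_primeFactors]
  constructor
  · rintro ⟨⟨h1, -, -⟩, h2⟩; exact ⟨h1, h2⟩
  · rintro ⟨h1, h2⟩
    refine ⟨⟨h1, ?_, Fintype.card_ne_zero⟩, h2⟩
    by_contra hd
    apply h2
    have hc : IsCoprime (q : ℤ) (Fintype.card R : ℤ) :=
      Nat.isCoprime_iff_coprime.mpr ((Nat.Prime.coprime_iff_not_dvd h1).mpr hd)
    obtain ⟨a, b, hab⟩ := hc
    have := congrArg (Int.cast : ℤ → R) hab
    push_cast at this
    rw [Nat.cast_card_eq_zero, mul_zero, add_zero] at this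
    exact IsUnit.of_mul_eq_one (a : R) (by rw [mul_comm]; exact this)

/-- a proper ideal is contained in a maximal ideal containing some bad prime -/
lemma exists_prime_of_ne_top (I : Ideal R) (hI : I ≠ ⊤) :
    ∃ q ∈ PP R, ∃ m : Ideal R, m ≠ ⊤ ∧ I ≤ m ∧ (q : R) ∈ m := by
  obtain ⟨m, hm, hIm⟩ := Ideal.exists_le_maximal I hI
  have hf : (Fintype.card R : R) ∈ m := by rw [Nat.cast_card_eq_zero]; exact m.zero_mem
  have hp : m.IsPrime := hm.isPrime
  have hne : Fintype.card R ≠ 0 := Fintype.card_ne_zero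
  rw [← Nat.prod_primeFactorsList hne, Nat.cast_list_prod] at hf
  have : ∃ q ∈ (Fintype.card R).primeFactorsList, (q : R) ∈ m := by
    by_contra hcon
    push Not at hcon
    have : ∀ l : List ℕ, (∀ q ∈ l, (q : R) ∉ m) → (l.map (Nat.cast : ℕ → R)).prod ∉ m := by
      intro l
      induction l with
      | nil => intro _; simpa using (Ideal.ne_top_iff_one m).mp hm.ne_top
      | cons a l ih =>
        intro h
        simp only [List.map_cons, List.prod_cons]
        intro h'
        rcases hp.mem_or_mem h' with h1 | h1
        · exact h a (by simp) h1
        · exact ih (fun q hq => h q (by simp [hq])) h1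
    exact this _ hcon hf
  obtain ⟨q, hq, hqm⟩ := this
  refine ⟨q, mem_PP.mpr ⟨Nat.prime_of_mem_primeFactorsList hq, ?_⟩, m, hm.ne_top, hIm, hqm⟩
  intro hu
  exact hm.ne_top (Ideal.eq_top_of_isUnit_mem _ hqm hu)

variable {e : ℕ → R} {k : ℕ → ℕ}

lemma orth (H : ∀ q ∈ PP R, QD q (e q) (k q)) {q r : ℕ} (hq : q ∈ PP R) (hr : r ∈ PP R)
    (hqr : q ≠ r) : e q * e r = 0 := by
  have hc : IsCoprime ((q : ℤ) ^ k q) ((r : ℤ) ^ k r) := by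
    apply IsCoprime.pow
    exact Nat.isCoprime_iff_coprime.mpr
      ((Nat.coprime_primes (mem_PP.mp hq).1 (mem_PP.mp hr).1).mpr hqr)
  obtain ⟨a, b, hab⟩ := hc
  have := congrArg (Int.cast : ℤ → R) hab
  push_cast at this
  linear_combination (-(e q * e r)) * this + a * e r * (H q hq).kill + b * e q * (H r hr).kill

lemma ideal_top_of_e (H : ∀ q ∈ PP R, QD q (e q) (k q)) (J : Ideal R)
    (hJ : ∀ q ∈ PP R, e q ∈ J) : J = ⊤ := by
  by_contra hne
  obtain ⟨q, hq, m, hm, hJm, hqm⟩ := exists_prime_of_ne_top J hne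
  obtain ⟨t, ht⟩ := (H q hq).inv
  apply hm
  rw [Ideal.eq_top_iff_one]
  have : (1 : R) = q * t + e q := by rw [ht]; ring
  rw [this]
  exact m.add_mem (m.mul_mem_right _ hqm) (hJm (hJ q hq))

lemma sum_e (H : ∀ q ∈ PP R, QD q (e q) (k q)) : ∑ q ∈ PP R, e q = 1 := by
  classical
  have h1 : ∀ q ∈ PP R, (∑ r ∈ PP R, e r) * e q = e q := by
    intro q hq
    rw [Finset.sum_mul, Finset.sum_eq_single q]
    · exact (H q hq).idem
    · intro r hr hrq; exact orth H hr hq hrq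
    · intro h; exact absurd hq h
  have hJ : Ideal.span {x : R | (1 - ∑ r ∈ PP R, e r) * x = 0} = ⊤ := by
    apply ideal_top_of_e H
    intro q hq
    apply Ideal.subset_span
    have := h1 q hq
    show (1 - ∑ r ∈ PP R, e r) * e q = 0
    linear_combination -this
  have : ∀ x ∈ Ideal.span {x : R | (1 - ∑ r ∈ PP R, e r) * x = 0}, (1 - ∑ r ∈ PP R, e r) * x = 0 := by
    intro x hx
    induction hx using Submodule.span_induction with
    | mem x h => exact h
    | zero => simp
    | add x y _ _ hx hy => rw [mul_add, hx, hy, add_zero]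
    | smul a x _ hx => rw [smul_eq_mul, mul_left_comm, hx, mul_zero]
  have := this 1 (by rw [hJ]; trivial)
  rw [mul_one] at this
  exact (sub_eq_zero.mp this).symm

lemma mem_ideal_iff_e (H : ∀ q ∈ PP R, QD q (e q) (k q)) (I : Ideal R) (x : R) :
    x ∈ I ↔ ∀ q ∈ PP R, e q * x ∈ I := by
  constructor
  · intro h q _; exact I.mul_mem_left _ h
  · intro h
    rw [← one_mul x, ← sum_e H, Finset.sum_mul]
    exact I.sum_mem h

/-- An additive subgroup closed under multiplication by units is an ideal. -/
lemma ideal_of_units (H : ∀ q ∈ PP R, QD q (e q) (k q)) (V : AddSubgroup R)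
    (hV : ∀ u : Rˣ, ∀ v ∈ V, (u : R) * v ∈ V) : ∃ I : Ideal R, (I : Set R) = V := by
  refine ⟨{ carrier := V, add_mem' := V.add_mem, zero_mem' := V.zero_mem, smul_mem' := ?_ }, rfl⟩
  intro c x hx
  show c * x ∈ V
  rw [← one_mul c, ← sum_e H, Finset.sum_mul, Finset.sum_mul]
  apply V.sum_mem
  intro q hq
  obtain ⟨b, u, -, hb⟩ := (H q hq).val c
  obtain ⟨m, hm⟩ := (H q hq).int
  rw [hb]
  have : (q : R) ^ b * e q * u * x = ((q : ℤ) ^ b * m) • ((u : R) * x) := by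
    rw [zsmul_eq_mul, hm]; push_cast; ring
  rw [this]
  exact V.zsmul_mem (hV u x hx) _

lemma isUnit_of_forall (h : CGp R) (r : R) (hr : ∀ q ∈ PP R, ¬ (q : R) ∣ r) : IsUnit r := by
  by_contra hu
  have : Ideal.span {r} ≠ ⊤ := by rwa [Ne, Ideal.span_singleton_eq_top]
  obtain ⟨q, hq, m, hm, hIm, hqm⟩ := exists_prime_of_ne_top _ this
  rcases h q (mem_PP.mp hq).1 r with h1 | ⟨y, s, hs⟩
  · exact hr q hq h1
  · apply hm
    rw [Ideal.eq_top_iff_one]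
    have h1 : r ∈ m := hIm (Ideal.mem_span_singleton_self r)
    have : (1 : R) = r * y - q * s := by rw [← hs]; ring
    rw [this]
    exact m.sub_mem (m.mul_mem_right _ h1) (m.mul_mem_right _ hqm)


lemma unit_lift (V : Ideal R) (x : R) (hx : IsUnit (Ideal.Quotient.mk V x)) :
    ∃ u : Rˣ, Ideal.Quotient.mk V (u : R) = Ideal.Quotient.mk V x := by
  obtain ⟨N, hN, hid⟩ := finite_exists_idem_pow x
  set f := x ^ N with hf
  have h1 : Ideal.Quotient.mk V f = 1 := by
    have h2 := congrArg (Ideal.Quotient.mk V) hid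
    rw [map_mul] at h2
    have h3 : IsUnit (Ideal.Quotient.mk V f) := by rw [hf, map_pow]; exact hx.pow N
    exact h3.mul_left_cancel (by rw [h2, mul_one])
  have h4 : (x * f + (1 - f)) * (x ^ (N - 1) * f + (1 - f)) = 1 := by
    have : x * x ^ (N - 1) = f := by rw [← pow_succ', Nat.sub_add_cancel hN]
    linear_combination f * f * this + (f + 1 - x - x ^ (N-1) + 1) * hid
  refine ⟨Units.mkOfMulEqOne _ _ h4, ?_⟩
  simp [h1]

lemma CGp.quot (h : CGp R) (V : Ideal R) : CGp (R ⧸ V) := by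
  intro q hq x
  obtain ⟨x, rfl⟩ := Ideal.Quotient.mk_surjective x
  rcases h q hq x with ⟨t, ht⟩ | ⟨y, s, hs⟩
  · left; exact ⟨Ideal.Quotient.mk V t, by rw [ht]; simp⟩
  · right; exact ⟨Ideal.Quotient.mk V y, Ideal.Quotient.mk V s, by
      rw [← map_mul, ← map_one (Ideal.Quotient.mk V), ← map_sub, hs]; simp⟩

lemma exists_QDs (h : CGp R) : ∃ e : ℕ → R, ∃ k : ℕ → ℕ, ∀ q ∈ PP R, QD q (e q) (k q) := by
  have : ∀ q : ℕ, ∃ e : R, ∃ k, q ∈ PP R → QD q e k := by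
    intro q
    by_cases hq : q ∈ PP R
    · obtain ⟨e, k, hh⟩ := exists_QD h q (mem_PP.mp hq).1 (mem_PP.mp hq).2
      exact ⟨e, k, fun _ => hh⟩
    · exact ⟨0, 0, fun h => absurd h hq⟩
  choose e k hek using this
  exact ⟨e, k, hek⟩

end ring


/-- convolution -/
def cv {R k : Type*} [AddCommGroup R] [Fintype R] [CommRing k] (f g : R → k) : R → k :=
  fun z => ∑ x, f x * g (z - x)

structure SA (R : Type*) [CommRing R] [Fintype R] where
  inv : Set (R → ℤ)
  comp2 : ∀ (φ : ℤ → ℤ → ℤ) (f g : R → ℤ), f ∈ inv → g ∈ inv → (fun x => φ (f x) (g x)) ∈ inv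
  conv : ∀ f g : R → ℤ, f ∈ inv → g ∈ inv → cv f g ∈ inv
  unit : ∀ (u : Rˣ) (f : R → ℤ), f ∈ inv → (fun x => f (u * x)) ∈ inv
  zero : ∃ f ∈ inv, ∀ x, f x ≠ 0 ↔ x = 0

section toA
variable {R k : Type*} [AddCommGroup R] [Fintype R] [CommRing k]

noncomputable def toA (f : R → k) : AddMonoidAlgebra k R := ∑ x, AddMonoidAlgebra.single x (f x)

lemma toA_mul (f g : R → k) : toA f * toA g = toA (cv f g) := by
  classical
  unfold toA cv
  rw [Finset.sum_mul_sum]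
  simp_rw [AddMonoidAlgebra.single_mul_single]
  have : ∀ x : R, ∑ y : R, AddMonoidAlgebra.single (x + y) (f x * g y)
      = ∑ z : R, AddMonoidAlgebra.single z (f x * g (z - x)) := by
    intro x
    apply Fintype.sum_equiv (Equiv.addLeft x)
    intro y
    simp
  simp_rw [this]
  rw [Finset.sum_comm]
  refine Finset.sum_congr rfl fun z _ => ?_
  exact (map_sum (AddMonoidAlgebra.singleAddHom (R := k) z) _ _).symm

lemma toA_inj {f g : R → k} (h : toA f = toA g) : f = g := by
  classical
  have key : ∀ (f : R → k) (z : R), (toA f).coeff z = f z := by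
    intro f z
    unfold toA
    simp [AddMonoidAlgebra.coeff_sum, Finsupp.single_apply]
  funext z
  rw [← key f, h, key]

end toA

namespace SA
variable {R : Type*} [CommRing R] [Fintype R] (A : SA R)

/-- `A`-sets. -/
def ASet (T : Set R) : Prop := ∃ f ∈ A.inv, ∀ x, x ∈ T ↔ f x ≠ 0

variable {A}

lemma comp1 (φ : ℤ → ℤ) {f : R → ℤ} (hf : f ∈ A.inv) : (fun x => φ (f x)) ∈ A.inv :=
  A.comp2 (fun a _ => φ a) f f hf hf

open Classical in
lemma ASet.ind {T : Set R} (h : A.ASet T) : (fun x => if x ∈ T then (1 : ℤ) else 0) ∈ A.inv := by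
  obtain ⟨f, hf, hT⟩ := h
  have := A.comp1 (fun a => if a ≠ 0 then 1 else 0) hf
  convert this using 3 with x
  exact hT x

lemma aset_of_pred {f : R → ℤ} (hf : f ∈ A.inv) (Q : ℤ → Prop) : A.ASet {x | Q (f x)} := by
  classical
  refine ⟨_, A.comp1 (fun a => if Q a then 1 else 0) hf, fun x => ?_⟩
  simp

lemma aset_univ : A.ASet Set.univ := by
  obtain ⟨f, hf, -⟩ := A.zero
  simpa using aset_of_pred hf (fun _ => True)

lemma aset_zero : A.ASet {0} := by
  obtain ⟨f, hf, h⟩ := A.zero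
  exact ⟨f, hf, fun x => (h x).symm⟩

lemma ASet.bool {T U : Set R} (hT : A.ASet T) (hU : A.ASet U) (B : Prop → Prop → Prop) :
    A.ASet {x | B (x ∈ T) (x ∈ U)} := by
  classical
  obtain ⟨f, hf, hT⟩ := hT
  obtain ⟨g, hg, hU⟩ := hU
  refine ⟨_, A.comp2 (fun a b => if B (a ≠ 0) (b ≠ 0) then 1 else 0) f g hf hg, fun x => ?_⟩
  simp [hT, hU]

lemma ASet.union {T U : Set R} (hT : A.ASet T) (hU : A.ASet U) : A.ASet (T ∪ U) :=
  hT.bool hU Or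

lemma ASet.inter {T U : Set R} (hT : A.ASet T) (hU : A.ASet U) : A.ASet (T ∩ U) :=
  hT.bool hU And

lemma ASet.unit {T : Set R} (hT : A.ASet T) (u : Rˣ) : A.ASet {x | (u : R) * x ∈ T} := by
  obtain ⟨f, hf, hT⟩ := hT
  exact ⟨_, A.unit u f hf, fun x => hT _⟩

lemma ASet.add {T U : Set R} (hT : A.ASet T) (hU : A.ASet U) : A.ASet (T + U) := by
  classical
  refine ⟨_, A.conv _ _ hT.ind hU.ind, fun z => ?_⟩
  unfold cv
  rw [Ne, Finset.sum_eq_zero_iff_of_nonneg (fun x _ => by positivity)]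
  push Not
  constructor
  · rintro ⟨t, ht, u, hu, rfl⟩
    exact ⟨t, Finset.mem_univ _, by simp [ht, hu]⟩
  · rintro ⟨x, -, hx⟩
    simp only [ne_eq, mul_eq_zero, not_or, ite_eq_right_iff, one_ne_zero, imp_false, not_not] at hx
    exact ⟨x, hx.1, z - x, hx.2, by simp⟩

/-- atom -/
def atom (A : SA R) (x : R) : Set R := {z | ∀ f ∈ A.inv, f z = f x}

lemma mem_atom_self (x : R) : x ∈ A.atom x := fun _ _ => rfl

lemma ASet.atom_subset {T : Set R} (hT : A.ASet T) {x : R} (hx : x ∈ T) : A.atom x ⊆ T := by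
  obtain ⟨f, hf, hT⟩ := hT
  intro z hz
  rw [hT, hz f hf, ← hT]; exact hx

lemma atom_symm {x z : R} (h : z ∈ A.atom x) : x ∈ A.atom z := fun f hf => (h f hf).symm

lemma atom_trans {x y z : R} (h : z ∈ A.atom y) (h' : y ∈ A.atom x) : z ∈ A.atom x :=
  fun f hf => (h f hf).trans (h' f hf)

lemma aset_biInter {ι : Type*} (s : Finset ι) (T : ι → Set R) (h : ∀ i ∈ s, A.ASet (T i)) :
    A.ASet {x | ∀ i ∈ s, x ∈ T i} := by
  classical
  induction s using Finset.induction_on with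
  | empty => simpa using A.aset_univ
  | insert a s ha ih =>
    have h1 := (h a (by simp)).inter (ih (fun i hi => h i (by simp [hi])))
    convert h1 using 1
    ext x; simp

lemma aset_atom (x : R) : A.ASet (A.atom x) := by
  classical
  have : ∀ z : R, ∃ f ∈ A.inv, z ∉ A.atom x → f z ≠ f x := by
    intro z
    by_cases hz : z ∈ A.atom x
    · obtain ⟨f, hf, -⟩ := A.zero
      exact ⟨f, hf, fun h => absurd hz h⟩
    · unfold atom at hz
      simp only [Set.mem_ofPred_eq] at hz
      push Not at hz
      obtain ⟨f, hf, h⟩ := hz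
      exact ⟨f, hf, fun _ => h⟩
  choose F hF hFz using this
  have h := aset_biInter (A := A) Finset.univ (fun z => {w | F z w = F z x})
    (fun z _ => aset_of_pred (hF z) (fun a => a = F z x))
  convert h using 1
  ext w
  constructor
  · intro hw z _; exact hw _ (hF z)
  · intro hw
    by_contra hcon
    exact hFz w hcon (hw w (Finset.mem_univ _))

/-- Schur's theorem on multiplication by a prime. -/
lemma schur {f : R → ℤ} (hf : f ∈ A.inv) (q : ℕ) (hq : q.Prime) [DecidableEq R] :
    (fun z => (∑ x with (q : R) * x = z, f x) % (q : ℤ)) ∈ A.inv := by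
  have hpow : ∀ n : ℕ, ∃ g ∈ A.inv, toA f ^ (n + 1) = toA g := by
    intro n
    induction n with
    | zero => exact ⟨f, hf, by simp⟩
    | succ n ih =>
      obtain ⟨g, hg, h⟩ := ih
      exact ⟨_, A.conv g f hg hf, by rw [pow_succ, h, toA_mul]⟩
  obtain ⟨g, hg, hgf⟩ := hpow (q - 1)
  rw [Nat.sub_add_cancel hq.one_le] at hgf
  haveI : Fact q.Prime := ⟨hq⟩
  have hmap : ∀ f : R → ℤ, AddMonoidAlgebra.mapRingHom R (Int.castRingHom (ZMod q)) (toA f)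
      = toA (fun x => (f x : ZMod q)) := by
    intro f
    unfold toA
    rw [map_sum]
    simp
  have h1 := congrArg (AddMonoidAlgebra.mapRingHom R (Int.castRingHom (ZMod q))) hgf
  rw [map_pow, hmap, hmap] at h1
  have h2 : toA (fun x => (f x : ZMod q)) ^ q
      = toA (fun z => ∑ x with (q : R) * x = z, (f x : ZMod q)) := by
    haveI : CharP (AddMonoidAlgebra (ZMod q) R) q :=
      charP_of_injective_algebraMap (R := ZMod q) (FaithfulSMul.algebraMap_injective _ _) q
    unfold toA
    rw [sum_pow_char q]
    simp_rw [AddMonoidAlgebra.single_pow, ZMod.pow_card, nsmul_eq_mul]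
    symm
    have : ∀ z : R, AddMonoidAlgebra.single z (∑ x with (q : R) * x = z, (f x : ZMod q))
        = ∑ x with (q : R) * x = z, AddMonoidAlgebra.single ((q : R) * x) (f x : ZMod q) := by
      intro z
      have h3 := map_sum (AddMonoidAlgebra.singleAddHom (R := ZMod q) z) (fun x => (f x : ZMod q))
        (Finset.univ.filter (fun x => (q : R) * x = z))
      refine h3.trans (Finset.sum_congr rfl fun x hx => ?_)
      rw [(Finset.mem_filter.mp hx).2]; rfl
    simp_rw [this]
    exact Finset.sum_fiberwise _ _ _
  have h3 := toA_inj (h2.symm.trans h1)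
  have h4 := A.comp1 (fun a => a % (q : ℤ)) hg
  convert h4 using 2 with z
  have h5 := congrFun h3 z
  have h6 : ((∑ x with (q : R) * x = z, f x : ℤ) : ZMod q) = ((g z : ℤ) : ZMod q) := by
    push_cast; exact h5
  exact (ZMod.intCast_eq_intCast_iff _ _ q).mp h6

/-- quotient -/
def quot (A : SA R) (V : Ideal R) [Fintype (R ⧸ V)] (hV : A.ASet (V : Set R)) : SA (R ⧸ V) where
  inv := {f | (fun x => f (Ideal.Quotient.mk V x)) ∈ A.inv}
  comp2 φ f g hf hg := A.comp2 φ _ _ hf hg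
  conv f g hf hg := by
    classical
    set π := Ideal.Quotient.mk V with hπ
    have h1 := A.conv _ _ hf hg
    set c : ℤ := ((Finset.univ.filter (fun x : R => π x = 0)).card : ℤ) with hc
    have hc0 : c ≠ 0 := by
      rw [hc]
      simp only [ne_eq, Nat.cast_eq_zero, Finset.card_eq_zero]
      intro h
      have : (0 : R) ∈ (∅ : Finset R) := by rw [← h]; simp
      simp at this
    have hfib : ∀ w : R ⧸ V, ((Finset.univ.filter (fun x : R => π x = w)).card : ℤ) = c := by
      intro w
      obtain ⟨y, rfl⟩ := Ideal.Quotient.mk_surjective w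
      rw [hc]
      congr 1
      apply Finset.card_bij (fun x _ => x - y)
      · intro x hx; simp at hx ⊢; rw [hx]; simp [hπ]
      · intro a _ b _ h; simpa using h
      · intro b hb; refine ⟨b + y, ?_, by simp⟩; simp at hb ⊢; rw [hb]; simp [hπ]
    have h2 : cv (fun x => f (π x)) (fun x => g (π x)) = fun z => c * cv f g (π z) := by
      funext z
      unfold cv
      rw [Finset.mul_sum]
      rw [← Finset.sum_fiberwise (s := Finset.univ) (g := fun x => π x)]
      refine Finset.sum_congr rfl fun w _ => ?_
      rw [← hfib w, ← nsmul_eq_mul, ← Finset.sum_const]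
      refine Finset.sum_congr rfl fun x hx => ?_
      show f (π x) * g (π (z - x)) = _
      rw [map_sub, (Finset.mem_filter.mp hx).2]
    rw [h2] at h1
    have h3 := A.comp1 (fun a => a / c) h1
    simp only [Int.mul_ediv_cancel_left _ hc0] at h3
    exact h3
  unit u f hf := by
    obtain ⟨x, hx⟩ := Ideal.Quotient.mk_surjective (u : R ⧸ V)
    obtain ⟨v, hv⟩ := unit_lift V x (by rw [hx]; exact u.isUnit)
    have := A.unit v _ hf
    show _ ∈ A.inv
    convert this using 3 with z
    rw [map_mul, hv, hx]
  zero := by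
    classical
    refine ⟨fun x => if x = 0 then 1 else 0, ?_, fun x => by simp⟩
    show _ ∈ A.inv
    convert hV.ind using 3 with x
    rw [Ideal.Quotient.eq_zero_iff_mem]; rfl

def UInv (T : Set R) : Prop := ∀ u : Rˣ, ∀ x ∈ T, (u : R) * x ∈ T

variable {e : ℕ → R} {k : ℕ → ℕ}

/-- the radical of an `A`-set -/
lemma ASet.rad (H : ∀ q ∈ PP R, QD q (e q) (k q)) {T : Set R} (hT : A.ASet T) (hU : UInv T) :
    ∃ V : Ideal R, A.ASet (V : Set R) ∧ ∀ z, z ∈ V ↔ ∀ x ∈ T, x - z ∈ T := by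
  classical
  let V : AddSubgroup R :=
    { carrier := {z | ∀ x ∈ T, x - z ∈ T}
      add_mem' := by
        intro a b ha hb x hx
        have := hb _ (ha x hx)
        rwa [sub_sub] at this
      zero_mem' := by intro x hx; simpa using hx
      neg_mem' := by
        intro z hz x hx
        let φ : T → T := fun x => ⟨x.1 - z, hz x.1 x.2⟩
        have hinj : Function.Injective φ := by
          intro a b hab
          have := congrArg Subtype.val hab
          simp only [φ] at this
          exact Subtype.ext (sub_left_inj.mp this)
        obtain ⟨y, hy⟩ := (Finite.surjective_of_injective hinj) ⟨x, hx⟩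
        have := congrArg Subtype.val hy
        simp only [φ] at this
        rw [← this]; simpa using y.2 }
  have hVm : ∀ z, z ∈ V ↔ ∀ x ∈ T, x - z ∈ T := fun z => Iff.rfl
  obtain ⟨I, hI⟩ := ideal_of_units H V (by
    intro u v hv x hx
    have h1 := hU u _ (hv _ (hU u⁻¹ x hx))
    rw [mul_sub, ← mul_assoc] at h1
    simpa using h1)
  refine ⟨I, ?_, ?_⟩
  · rw [hI]
    have hneg := (hT.unit (-1)).ind
    refine ⟨_, A.comp1 (fun a => if a = ∑ x, (if x ∈ T then (1:ℤ) else 0) then 1 else 0)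
      (A.conv _ _ hT.ind hneg), fun z => ?_⟩
    simp only [ne_eq, ite_eq_right_iff, one_ne_zero, imp_false, not_not]
    unfold cv
    rw [eq_comm, ← sub_eq_zero, ← Finset.sum_sub_distrib,
      Finset.sum_eq_zero_iff_of_nonneg]
    · show (∀ x ∈ T, x - z ∈ T) ↔ _
      constructor
      · intro h x _
        by_cases hx : x ∈ T
        · have := h x hx
          simp [hx, this]
        · simp [hx]
      · intro h x hx
        have := h x (Finset.mem_univ _)
        by_contra hcon
        simp [hx, hcon] at this
    · intro x _
      by_cases h1 : x ∈ T <;> by_cases h2 : x - z ∈ T <;> simp [h1, h2]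
  · intro z
    rw [← hVm, ← SetLike.mem_coe, hI]; rfl

/-- the ideal generated by an `A`-set, inside a given ideal -/
lemma ASet.gen (H : ∀ q ∈ PP R, QD q (e q) (k q)) {E : Set R} (hE : A.ASet E) (hU : UInv E)
    (J : Ideal R) (hJ : E ⊆ J) :
    ∃ V : Ideal R, A.ASet (V : Set R) ∧ E ⊆ V ∧ V ≤ J := by
  classical
  let 𝒟 : Set (Set R) := {D | A.ASet D ∧ UInv D ∧ E ⊆ D ∧ (0 : R) ∈ D ∧ D ⊆ J}
  have hne : 𝒟.Nonempty := by
    refine ⟨E ∪ {0}, hE.union aset_zero, ?_, Set.subset_union_left, by simp, ?_⟩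
    · rintro u x (hx | hx)
      · left; exact hU u x hx
      · right; simp at hx ⊢; exact hx
    · rintro x (hx | hx)
      · exact hJ hx
      · simp at hx; rw [hx]; exact J.zero_mem
  obtain ⟨D, hD⟩ := (Set.toFinite 𝒟).exists_maximal hne
  obtain ⟨⟨h1, h2, h3, h4, h5⟩, hmax⟩ := hD
  have hsub : D ⊆ D + D := fun x hx => ⟨x, hx, 0, h4, by simp⟩
  have hDD : D + D ∈ 𝒟 := by
    refine ⟨h1.add h1, ?_, h3.trans hsub, hsub h4, ?_⟩
    · rintro u _ ⟨a, ha, b, hb, rfl⟩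
      exact ⟨u * a, h2 u a ha, u * b, h2 u b hb, by simp [mul_add]⟩
    · rintro _ ⟨a, ha, b, hb, rfl⟩
      exact J.add_mem (h5 ha) (h5 hb)
  have hle : D + D ⊆ D := hmax hDD hsub
  let V : AddSubgroup R :=
    { carrier := D
      add_mem' := fun {a b} ha hb => hle ⟨a, ha, b, hb, rfl⟩
      zero_mem' := h4
      neg_mem' := fun {x} hx => by simpa using h2 (-1) x hx }
  obtain ⟨I, hI⟩ := ideal_of_units H V h2
  have hI' : (I : Set R) = D := hI
  refine ⟨I, by rw [hI']; exact h1, by rw [hI']; exact h3, ?_⟩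
  intro x hx
  exact h5 (by rw [← hI']; exact hx)

end SA


namespace SA
section Lq
variable {R : Type*} [CommRing R] [Fintype R] {A : SA R} {q : ℕ} {e : R} {k : ℕ}

/-- invariance under units of the `q`-part -/
def QInv (e : R) (T : Set R) : Prop := ∀ v : Rˣ, (1 - e) * v = 1 - e → ∀ x ∈ T, (v : R) * x ∈ T

lemma UInv.qinv {T : Set R} (h : UInv T) (e : R) : QInv e T := fun v _ x hx => h v x hx

lemma QInv.iff {T : Set R} (h : QInv e T) {v : Rˣ} (hv : (1 - e) * v = 1 - e) (x : R) :
    (v : R) * x ∈ T ↔ x ∈ T := by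
  constructor
  · intro hx
    have h1 : (1 - e) * ((v⁻¹ : Rˣ) : R) = 1 - e := by
      have : (v : R) * ((v⁻¹ : Rˣ) : R) = 1 := by simp
      linear_combination (-((v⁻¹ : Rˣ) : R)) * hv + (1 - e) * this
    have := h v⁻¹ h1 _ hx
    simpa [← mul_assoc] using this
  · exact h v hv x

/-- The exceptional set. -/
def EE (e y : R) (T : Set R) : Set R := {x | e * x = 0 ∧ ¬ (x ∈ T ↔ x + y ∈ T)}

lemma T_shift (H : QD q e k) {T : Set R} (hT : QInv e T) {x w : R} (hx : e * x = 0)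
    (hw : (q : R) * w = 0) (h0 : w ≠ 0) : x + w ∈ T ↔ x + (q : R) ^ (k - 1) * e ∈ T := by
  obtain ⟨u, hu, hwu⟩ := H.kill_form hw h0
  have : x + w = u * (x + (q : R) ^ (k - 1) * e) := by
    rw [hwu]; linear_combination (-x) * hu - (u - 1) * hx
  rw [this, hT.iff hu]

lemma EE_uinv (H : QD q e k) {T : Set R} (hT : UInv T) : UInv (EE e ((q : R) ^ (k - 1) * e) T) := by
  have h1 : ∀ u : Rˣ, ∀ x, (u : R) * x ∈ T ↔ x ∈ T := by
    intro u x
    refine ⟨fun h => ?_, hT u x⟩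
    have := hT u⁻¹ _ h
    simpa [← mul_assoc] using this
  rintro u x ⟨hx, hxT⟩
  refine ⟨by linear_combination (u : R) * hx, ?_⟩
  have h2 : (u : R) * x + (q : R) ^ (k - 1) * e = u * (x + (u⁻¹ : Rˣ) * ((q : R) ^ (k - 1) * e)) := by
    rw [mul_add, ← mul_assoc (u : R) ((u⁻¹ : Rˣ) : R)]; simp
  rw [h1, h2, h1, T_shift H (hT.qinv e) hx]
  · exact hxT
  · linear_combination ((u⁻¹ : Rˣ) : R) * H.y_kill
  · intro h
    apply H.ne
    have := congrArg (fun z => (u : R) * z) h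
    simpa [← mul_assoc] using this

open Classical in
lemma dvd_card_kill (hq : q.Prime) (H : QD q e k) :
    (q : ℤ) ∣ ((Finset.univ.filter (fun w : R => (q : R) * w = 0)).card : ℤ) := by
  have h := addOrderOf_dvd_natCard (G := (AddMonoidHom.mulLeft (q : R)).ker)
    ⟨(q : R) ^ (k - 1) * e, by simpa using H.y_kill⟩
  have h1 : addOrderOf ((q : R) ^ (k - 1) * e) = q := by
    haveI : Fact q.Prime := ⟨hq⟩
    apply addOrderOf_eq_prime
    · rw [nsmul_eq_mul]; exact H.y_kill
    · exact H.ne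
  rw [AddSubgroup.addOrderOf_mk, h1] at h
  rw [Int.natCast_dvd_natCast]
  convert h using 1
  rw [Nat.card_eq_fintype_card]
  symm
  apply Fintype.card_of_subtype
  intro x
  simp

open Classical in
lemma fiber_sum (f : R → ℤ) (x₁ : R) :
    ∑ x with (q : R) * x = q * x₁, f x = ∑ w with (q : R) * w = 0, f (x₁ + w) := by
  symm
  apply Finset.sum_bij (fun w _ => x₁ + w)
  · intro w hw; simp at hw ⊢; rw [mul_add, hw, add_zero]
  · intro a _ b _ h; simpa using h
  · intro b hb; refine ⟨b - x₁, ?_, by simp⟩; simp at hb ⊢; rw [mul_sub, hb, sub_self]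
  · intro _ _; rfl

lemma aset_EE (hq : q.Prime) (H : QD q e k) {T : Set R} (hT : A.ASet T) (hI : QInv e T) :
    A.ASet (EE e ((q : R) ^ (k - 1) * e) T) := by
  classical
  have hs := schur hT.ind q hq
  obtain ⟨G, hG⟩ : ∃ G : R → ℤ, ∀ z, G z = (∑ x with (q : R) * x = z, if x ∈ T then (1 : ℤ) else 0) % q :=
    ⟨_, fun _ => rfl⟩
  rw [← funext hG] at hs
  obtain ⟨t, ht⟩ := H.inv
  have hu : ((q : R) * (1 - e) + e) * (t * (1 - e) + e) = 1 := by
    linear_combination (1 - e) * (1 - e) * ht + (3 - e - q - t) * H.idem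
  have h1 := A.unit (Units.mkOfMulEqOne _ _ hu) _ hs
  refine ⟨_, h1, fun x => ?_⟩
  simp only [Units.val_mkOfMulEqOne]
  set y := (q : R) ^ (k - 1) * e with hy
  set N : ℤ := ((Finset.univ.filter (fun w : R => (q : R) * w = 0)).card : ℤ) with hN
  have hdvd : (q : ℤ) ∣ N := dvd_card_kill hq H
  have hq2 : (2 : ℤ) ≤ q := by exact_mod_cast hq.two_le
  by_cases hx : e * x = 0
  · have h2 : ((q : R) * (1 - e) + e) * x = q * x := by linear_combination (1 - q) * hx
    rw [h2, hG, fiber_sum]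
    have h0 : (0 : R) ∈ Finset.univ.filter (fun w : R => (q : R) * w = 0) := by simp
    rw [← Finset.add_sum_erase _ _ h0]
    have h3 : ∀ w ∈ (Finset.univ.filter (fun w : R => (q : R) * w = 0)).erase 0,
        (if x + w ∈ T then (1 : ℤ) else 0) = if x + y ∈ T then 1 else 0 := by
      intro w hw
      simp only [Finset.mem_erase, Finset.mem_filter, Finset.mem_univ, true_and] at hw
      simp only [T_shift H hI hx hw.2 hw.1, hy]
    rw [Finset.sum_congr rfl h3, Finset.sum_const, Finset.card_erase_of_mem h0, nsmul_eq_mul,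
      Nat.cast_sub (Finset.card_pos.mpr ⟨0, h0⟩), ← hN, add_zero]
    obtain ⟨c, hc⟩ := hdvd
    have h4 : x ∈ EE e y T ↔ ¬ (x ∈ T ↔ x + y ∈ T) := ⟨fun h => h.2, fun h => ⟨hx, h⟩⟩
    rw [h4]
    by_cases a : x ∈ T <;> by_cases b : x + y ∈ T <;> simp only [a, b, if_true, if_false,
      iff_true, iff_false, not_true, not_false_iff, true_iff, Nat.cast_one, mul_one, mul_zero]
    · rw [hc]; simp
    · simp only [add_zero]
      rw [Int.emod_eq_of_lt (by norm_num) (by omega)]; simp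
    · rw [hc]
      simp only [ne_eq]
      intro h
      have := Int.dvd_of_emod_eq_zero h
      have h5 : (q : ℤ) ∣ 1 := by
        have h6 : (q : ℤ) ∣ q * c := Dvd.intro _ rfl
        have := dvd_sub h6 this
        have h7 : (q : ℤ) * c - (0 + (q * c - 1)) = 1 := by ring
        rw [← h7]; exact this
      have := Int.le_of_dvd (by norm_num) h5
      omega
    · simp
  · have h4 : x ∉ EE e y T := fun h => hx h.1
    simp only [h4, false_iff, not_not, ne_eq]
    by_cases hex : ∃ x₁, (q : R) * x₁ = ((q : R) * (1 - e) + e) * x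
    · obtain ⟨x₁, hx1⟩ := hex
      rw [← hx1, hG, fiber_sum]
      have h5 : (q : R) * (e * x₁) ≠ 0 := by
        intro h; apply hx
        linear_combination h - e * hx1 - (x - q * x) * H.idem
      have h3 : ∀ w ∈ (Finset.univ.filter (fun w : R => (q : R) * w = 0)),
          (if x₁ + w ∈ T then (1 : ℤ) else 0) = if x₁ ∈ T then 1 else 0 := by
        intro w hw
        simp only [Finset.mem_filter, Finset.mem_univ, true_and] at hw
        obtain ⟨v, hv, hvx⟩ := H.coset_unit h5 hw
        simp only [hvx, hI.iff hv]
      rw [Finset.sum_congr rfl h3, Finset.sum_const, nsmul_eq_mul, ← hN]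
      obtain ⟨c, hc⟩ := hdvd
      rw [hc, mul_assoc]; exact Int.mul_emod_right _ _
    · rw [hG, Finset.filter_false_of_mem]
      · simp
      · intro z _ h; exact hex ⟨z, h⟩

lemma EE_empty (H : QD q e k) {T : Set R} (hI : QInv e T)
    (hE : EE e ((q : R) ^ (k - 1) * e) T = ∅) {x w : R} (hx : x ∈ T) (hw : (q : R) * w = 0) :
    x + w ∈ T := by
  by_cases h5 : (q : R) * (e * x) = 0
  · have h0 : e * ((1 - e) * x) = 0 := by linear_combination (-x) * H.idem
    have key : ∀ w, (q : R) * w = 0 → ((1 - e) * x + w ∈ T ↔ (1 - e) * x ∈ T) := by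
      intro w hw
      by_cases hw0 : w = 0
      · simp [hw0]
      · rw [T_shift H hI h0 hw hw0]
        by_contra hcon
        have : (1 - e) * x ∈ EE e ((q : R) ^ (k - 1) * e) T := ⟨h0, fun h => hcon h.symm⟩
        rw [hE] at this; exact this
    have h1 : x + w = (1 - e) * x + (e * x + w) := by ring
    have h2 : x = (1 - e) * x + (e * x) := by ring
    rw [h1, key _ (by rw [mul_add, h5, hw, add_zero])]
    rw [← key _ h5, ← h2]; exact hx
  · obtain ⟨v, hv, hvx⟩ := H.coset_unit h5 hw
    rw [hvx]; exact hI v hv x hx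

end Lq

/-- in no proper `A`-ideal -/
def Gen {R : Type*} [CommRing R] [Fintype R] (A : SA R) (x : R) : Prop :=
  ∀ V : Ideal R, A.ASet (V : Set R) → x ∈ V → V = ⊤

section
variable {R : Type*} [CommRing R] [Fintype R] {A : SA R}

lemma Gen.atom {a b : R} (h : A.Gen a) (hb : b ∈ A.atom a) : A.Gen b :=
  fun V hV hbV => h V hV (hV.atom_subset hbV (atom_symm hb))

lemma aset_inf {V W : Ideal R} (hV : A.ASet (V : Set R)) (hW : A.ASet (W : Set R)) :
    A.ASet ((V ⊓ W : Ideal R) : Set R) := by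
  have := hV.inter hW
  exact this

lemma aset_sup {V W : Ideal R} (hV : A.ASet (V : Set R)) (hW : A.ASet (W : Set R)) :
    A.ASet ((V ⊔ W : Ideal R) : Set R) := by
  have := hV.add hW
  convert this using 1
  exact Submodule.coe_sup V W

end

theorem plemma (n : ℕ) : ∀ (R : Type*) [CommRing R] [Fintype R], Fintype.card R = n → CGp R →
    ∀ (A : SA R), (∀ f ∈ A.inv, ∀ (u : Rˣ) x, f (u * x) = f x) →
    ∀ x y, A.Gen x → A.Gen y → y ∈ A.atom x := by
  classical
  induction n using Nat.strong_induction_on with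
  | _ n ih =>
  intro R _ _ hn hCG A hA x₀ y₀ hx₀ hy₀
  have hat : ∀ a, UInv (A.atom a) := fun a u z hz f hf => (hA f hf u z).trans (hz f hf)
  obtain ⟨e, k, H⟩ := exists_QDs hCG
  -- step 1
  have s1 : ∀ V : Ideal R, A.ASet (V : Set R) → V ≠ ⊥ → ∀ a b, A.Gen a → A.Gen b →
      ∃ a' ∈ A.atom a, a' - b ∈ V := by
    intro V hV hV0 a b ha hb
    haveI : Fintype (R ⧸ V) := Fintype.ofFinite _
    have hcard : Fintype.card (R ⧸ V) < n := by
      rw [← hn]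
      refine lt_of_le_of_ne (Fintype.card_le_of_surjective _ Ideal.Quotient.mk_surjective) ?_
      intro hc
      have hbij := (Fintype.bijective_iff_surjective_and_card (Ideal.Quotient.mk V)).mpr
        ⟨Ideal.Quotient.mk_surjective, hc.symm⟩
      apply hV0
      rw [eq_bot_iff]
      intro v hv
      apply hbij.1
      rw [map_zero]; exact Ideal.Quotient.eq_zero_iff_mem.mpr hv
    have hgen : ∀ c, A.Gen c → (A.quot V hV).Gen (Ideal.Quotient.mk V c) := by
      intro c hc W hW hcW
      have h1 : A.ASet ((W.comap (Ideal.Quotient.mk V) : Ideal R) : Set R) := by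
        obtain ⟨f, hf, hfW⟩ := hW
        exact ⟨_, hf, fun x => hfW _⟩
      have h2 := hc _ h1 hcW
      rw [Ideal.eq_top_iff_one] at h2 ⊢
      simpa using h2
    have h3 := ih _ hcard (R ⧸ V) rfl (hCG.quot V) (A.quot V hV) (by
      intro f hf u z
      obtain ⟨x, hx⟩ := Ideal.Quotient.mk_surjective (u : R ⧸ V)
      obtain ⟨v, hv⟩ := unit_lift V x (by rw [hx]; exact u.isUnit)
      obtain ⟨z, rfl⟩ := Ideal.Quotient.mk_surjective z
      have := hA _ hf v z
      rw [map_mul, hv, hx] at this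
      exact this) _ _ (hgen a ha) (hgen b hb)
    have h4 : (fun w : R ⧸ V => if ∃ z ∈ A.atom a, Ideal.Quotient.mk V z = w then (1 : ℤ) else 0) ∈
        (A.quot V hV).inv := by
      show _ ∈ A.inv
      convert (A.aset_atom a |>.add hV).ind using 3 with z
      rw [Set.mem_add]
      constructor
      · rintro ⟨x, hx, hxz⟩
        exact ⟨x, hx, z - x, by
          rw [SetLike.mem_coe, ← Ideal.Quotient.eq_zero_iff_mem, map_sub, hxz, sub_self], by simp⟩
      · rintro ⟨x, hx, v, hv, rfl⟩
        refine ⟨x, hx, ?_⟩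
        rw [map_add, Ideal.Quotient.eq_zero_iff_mem.mpr hv, add_zero]
    have h5 := h3 _ h4
    have h6 : ∃ z ∈ A.atom a, Ideal.Quotient.mk V z = Ideal.Quotient.mk V a := ⟨a, mem_atom_self a, rfl⟩
    simp only [h6, if_true] at h5
    have h7 : ∃ z ∈ A.atom a, Ideal.Quotient.mk V z = Ideal.Quotient.mk V b := by
      by_contra hcon
      rw [if_neg hcon] at h5; exact absurd h5 (by norm_num)
    obtain ⟨z, hz, hzb⟩ := h7
    exact ⟨z, hz, Ideal.Quotient.eq.mp hzb⟩
  -- step 2,3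
  have s2 : ∀ a b, A.Gen a → A.Gen b → b ∉ A.atom a → ∀ q ∈ PP R,
      (EE (e q) ((q : R) ^ (k q - 1) * e q) (A.atom a)).Nonempty ∧
      ∀ z ∈ EE (e q) ((q : R) ^ (k q - 1) * e q) (A.atom a), z + (q : R) ^ (k q - 1) * e q ∈ A.atom a := by
    intro a b ha hb hab q hq
    constructor
    · by_contra hne
      rw [Set.not_nonempty_iff_eq_empty] at hne
      obtain ⟨V, hV, hVm⟩ := (A.aset_atom a).rad H (hat a)
      have hy : (q : R) ^ (k q - 1) * e q ∈ V := by
        rw [hVm]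
        intro x hx
        rw [sub_eq_add_neg]
        exact EE_empty (H q hq) ((hat a).qinv _) hne hx (by rw [mul_neg, (H q hq).y_kill, neg_zero])
      obtain ⟨a', ha', hv⟩ := s1 V hV (by rintro rfl; exact (H q hq).ne hy) a b ha hb
      have := (hVm _).mp hv a' ha'
      rw [sub_sub_cancel] at this
      exact hab this
    · have hE := aset_EE (mem_PP.mp hq).1 (H q hq) (A.aset_atom a) ((hat a).qinv _)
      intro z hz
      by_contra hcon
      have h1 : z ∈ A.atom a := by
        by_contra h; exact hz.2 (iff_of_false h hcon)
      have h2 := hE.atom_subset hz (atom_symm h1)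
      obtain ⟨V, hV, hEV, hVJ⟩ := hE.gen H (EE_uinv (H q hq) (hat a))
        (LinearMap.ker (LinearMap.mulLeft R (e q))) (fun x hx => hx.1)
      have h3 := ha V hV (hEV h2)
      rw [h3] at hVJ
      have : (1 : R) ∈ LinearMap.ker (LinearMap.mulLeft R (e q)) := hVJ trivial
      simp at this
      exact (H q hq).e_ne this
  by_contra hxy
  have hyx : x₀ ∉ A.atom y₀ := fun h => hxy (atom_symm h)
  -- minimal ideal
  have htop : ({V : Ideal R | A.ASet (V : Set R) ∧ V ≠ ⊥} : Set (Ideal R)).Nonempty := by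
    refine ⟨⊤, aset_univ, ?_⟩
    intro h
    apply hxy
    have h1 : ∀ z : R, z = 0 := fun z => by
      have : z ∈ (⊤ : Ideal R) := trivial
      rw [h] at this; exact this
    rw [h1 x₀, h1 y₀]; exact mem_atom_self _
  obtain ⟨Z, ⟨hZ, hZ0⟩, hZmin⟩ := (Set.toFinite {V : Ideal R | A.ASet (V : Set R) ∧ V ≠ ⊥}).exists_minimal htop
  obtain ⟨q, hq, z, hz, hez⟩ : ∃ q ∈ PP R, ∃ z ∈ Z, e q * z ≠ 0 := by
    by_contra hcon
    push Not at hcon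
    apply hZ0
    rw [eq_bot_iff]
    intro z hz
    have := (mem_ideal_iff_e H ⊥ z).mpr (fun q hq => hcon q hq z hz)
    exact this
  set y := (q : R) ^ (k q - 1) * e q with hy
  have hyZ : y ∈ Z := (H q hq).y_mem Z hz hez
  obtain ⟨⟨a, haE⟩, hX⟩ := s2 x₀ y₀ hx₀ hy₀ hxy q hq
  obtain ⟨⟨d, hdE⟩, hY⟩ := s2 y₀ x₀ hy₀ hx₀ hyx q hq
  have hEX := aset_EE (mem_PP.mp hq).1 (H q hq) (A.aset_atom x₀) ((hat x₀).qinv _)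
  have hEY := aset_EE (mem_PP.mp hq).1 (H q hq) (A.aset_atom y₀) ((hat y₀).qinv _)
  obtain ⟨V, hV, hEV, hVJ⟩ := (hEX.union hEY).gen H (by
      rintro u x (hx | hx)
      · left; exact EE_uinv (H q hq) (hat x₀) u x hx
      · right; exact EE_uinv (H q hq) (hat y₀) u x hx)
    (LinearMap.ker (LinearMap.mulLeft R (e q))) (by rintro x (hx | hx) <;> exact hx.1)
  have hVZ : V ⊓ Z = ⊥ := by
    by_contra hne
    have h1 : Z ≤ V ⊓ Z := hZmin ⟨aset_inf hV hZ, hne⟩ inf_le_right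
    have h2 : e q * y = 0 := hVJ (h1 hyZ).1
    rw [(H q hq).e_y] at h2
    exact (H q hq).ne h2
  have hXD : A.atom x₀ ⊆ A.atom a + Z := by
    have h1 : a + y ∈ A.atom a + (Z : Set R) := ⟨a, mem_atom_self a, y, hyZ, rfl⟩
    have h2 := ((A.aset_atom a).add hZ).atom_subset h1
    intro z hz
    exact h2 (atom_trans hz (atom_symm (hX a haE)))
  obtain ⟨a', ha', hv⟩ := s1 Z hZ hZ0 x₀ (d + y) hx₀ (hy₀.atom (hY d hdE))
  obtain ⟨e', he', ζ, hζ, hsum⟩ := hXD ha'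
  have he'E := hEX.atom_subset haE he'
  have h3 : d - e' ∈ V ⊓ Z := by
    refine ⟨V.sub_mem (hEV (Or.inr hdE)) (hEV (Or.inl he'E)), ?_⟩
    have : d - e' = ζ - (a' - (d + y)) - y := by rw [← hsum]; simp only; ring
    rw [this]
    exact Z.sub_mem (Z.sub_mem hζ hv) hyZ
  rw [hVZ] at h3
  have h4 : d = e' := sub_eq_zero.mp h3
  have h5 := hX e' he'E
  rw [← h4] at h5
  exact hxy (atom_trans (atom_symm (hY d hdE)) h5)

end SA


section cg

lemma galois_nonunit {S : Type*} [CommRing S] [Finite S] [IsLocalRing S] {x : S} (hx : ¬ IsUnit x) :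
    IsNilpotent x := by
  obtain ⟨N, hN, h⟩ := finite_exists_idem_pow x
  rcases IsLocalRing.isUnit_or_isUnit_one_sub_self (x ^ N) with h1 | h1
  · exact absurd ((isUnit_pow_iff hN.ne').mp h1) hx
  · refine ⟨N, ?_⟩
    have : (1 - x ^ N) * x ^ N = 0 := by linear_combination -h
    rwa [h1.mul_right_eq_zero] at this

lemma CGp_of_equiv {R S : Type*} [CommRing R] [CommRing S] (φ : R ≃+* S) (h : CGp S) : CGp R := by
  intro q hq x
  rcases h q hq (φ x) with ⟨t, ht⟩ | ⟨y, s, hs⟩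
  · left; refine ⟨φ.symm t, φ.injective ?_⟩
    rw [ht]; simp
  · right; refine ⟨φ.symm y, φ.symm s, φ.injective ?_⟩
    simp [hs]

lemma CGp_of_isCG {R : Type*} [CommRing R] (h : IsCGRing R) : CGp R := by
  obtain ⟨n, S, instR, instF, hG, hco, ⟨φ⟩⟩ := h
  letI : ∀ i, CommRing (S i) := instR
  apply CGp_of_equiv φ
  choose p hp hloc hnil using hG
  haveI := hloc
  have hpn : ∀ i, IsNilpotent ((p i : ℕ) : S i) := by
    intro i
    rw [← mem_nilradical, hnil i]
    exact Ideal.mem_span_singleton_self _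
  have hdiv : ∀ i (x : S i), ¬ IsUnit x → ((p i : ℕ) : S i) ∣ x := by
    intro i x hx
    rw [← Ideal.mem_span_singleton, ← hnil i, mem_nilradical]
    exact galois_nonunit hx
  have hne : ∀ i j, i ≠ j → p i ≠ p j := by
    intro i j hij hpp
    have h1 : ∀ i, p i ∣ ringChar (S i) := by
      intro i
      obtain ⟨m, hm⟩ := hpn i
      have h2 : ringChar (S i) ∣ p i ^ m := (ringChar.spec (S i) _).mp (by push_cast; exact hm)
      obtain ⟨a, -, ha⟩ := (Nat.dvd_prime_pow (hp i)).mp h2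
      rw [ha]
      apply dvd_pow_self
      rintro rfl
      exact CharP.ringChar_ne_one (R := S i) (by simpa using ha)
    have := Nat.dvd_gcd (h1 i) (hpp ▸ h1 j)
    rw [hco i j hij] at this
    exact (hp i).one_lt.ne' (Nat.dvd_one.mp this)
  have hun : ∀ (q : ℕ), q.Prime → ∀ i, p i ≠ q → IsUnit (q : S i) := by
    intro q hq i hpq
    by_contra hcon
    obtain ⟨c, hc⟩ := hdiv i _ hcon
    have hcop : IsCoprime (p i : ℤ) (q : ℤ) :=
      Nat.isCoprime_iff_coprime.mpr ((Nat.coprime_primes (hp i) hq).mpr hpq)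
    obtain ⟨a, b, hab⟩ := hcop
    have h1 := congrArg (Int.cast : ℤ → S i) hab
    push_cast at h1
    have h2 : IsUnit ((p i : ℕ) : S i) := by
      apply IsUnit.of_mul_eq_one ((a : S i) + b * c)
      rw [hc] at h1
      linear_combination h1
    exact (hpn i).not_isUnit h2
  intro q hq x
  by_cases hx : ∀ i, p i = q → ¬ IsUnit (x i)
  · left
    have : ∀ i, ∃ t, x i = (q : S i) * t := by
      intro i
      by_cases hi : p i = q
      · have := hdiv i _ (hx i hi)
        rw [hi] at this; exact this
      · exact (hun q hq i hi).dvd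
    choose t ht using this
    exact ⟨t, funext fun i => by rw [ht i]; rfl⟩
  · right
    push Not at hx
    obtain ⟨i₀, hi0, hu⟩ := hx
    have : ∀ i, ∃ y t, x i * y - 1 = (q : S i) * t := by
      intro i
      by_cases hi : i = i₀
      · subst hi
        obtain ⟨y, hy⟩ := hu.exists_right_inv
        exact ⟨y, 0, by rw [hy]; simp⟩
      · obtain ⟨t, ht⟩ := (hun q hq i (by rw [← hi0]; exact hne i i₀ hi)).dvd (a := x i * 0 - 1)
        exact ⟨0, t, ht⟩
    choose y t ht using this
    exact ⟨y, t, funext fun i => by simpa using ht i⟩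

end cg

namespace SA
variable {R : Type*} [CommRing R] [Fintype R]

/-- unit-invariant part -/
def core (A : SA R) : SA R where
  inv := {f | f ∈ A.inv ∧ ∀ (u : Rˣ) x, f (u * x) = f x}
  comp2 φ f g hf hg := ⟨A.comp2 φ f g hf.1 hg.1, fun u x => by simp only [hf.2, hg.2]⟩
  conv f g hf hg := ⟨A.conv f g hf.1 hg.1, fun u x => by
    unfold cv
    symm
    apply Fintype.sum_equiv (Units.mulLeft u)
    intro z
    simp only [Units.mulLeft_apply]
    rw [← mul_sub, hf.2, hg.2]⟩
  unit u f hf := ⟨A.unit u f hf.1, fun v x => by simp only [hf.2]⟩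
  zero := by
    obtain ⟨f, hf, h⟩ := A.zero
    classical
    refine ⟨fun x => if f x ≠ 0 then 1 else 0, ⟨A.comp1 (fun a => if a ≠ 0 then 1 else 0) hf, ?_⟩, ?_⟩
    · intro u x; simp [h]
    · intro x; simp [h]

lemma gen_one (A : SA R) : A.Gen 1 := fun V _ h => (Ideal.eq_top_iff_one V).mpr h

/-- An element lying in no proper `A`-ideal has a unit in its atom. -/
lemma gen_unit (hCG : CGp R) (A : SA R) {x : R} (hx : A.Gen x) : ∃ u : Rˣ, (u : R) ∈ A.atom x := by
  classical
  have h1 : A.core.Gen x := by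
    rintro V ⟨f, hf, hV⟩
    exact hx V ⟨f, hf.1, hV⟩
  have h2 := plemma _ R rfl hCG A.core (fun f hf => hf.2) x 1 h1 (gen_one _)
  have h3 : A.ASet {z : R | ∃ u : Rˣ, (u : R) * z ∈ A.atom x} := by
    have := aset_biInter (A := A) (Finset.univ : Finset Rˣ) (fun u => {z | (u : R) * z ∈ A.atom x}ᶜ)
      (fun u _ => ((A.aset_atom x).unit u).bool (aset_univ) (fun a _ => ¬ a))
    have := this.bool aset_univ (fun a _ => ¬ a)
    convert this using 1
    ext z
    simp
  have h4 := h2 _ ⟨h3.ind, by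
    intro u z
    have : (∃ w : Rˣ, (w : R) * (u * z) ∈ A.atom x) ↔ ∃ w : Rˣ, (w : R) * z ∈ A.atom x := by
      constructor
      · rintro ⟨w, hw⟩; exact ⟨w * u, by simpa [mul_assoc] using hw⟩
      · rintro ⟨w, hw⟩; exact ⟨w * u⁻¹, by simpa [mul_assoc] using hw⟩
    simp only [Set.mem_ofPred_eq]
    by_cases hh : ∃ w : Rˣ, (w : R) * z ∈ A.atom x
    · rw [if_pos (this.mpr hh), if_pos hh]
    · rw [if_neg (fun h => hh (this.mp h)), if_neg hh]⟩
  have h5 : ∃ u : Rˣ, (u : R) * x ∈ A.atom x := ⟨1, by simpa using mem_atom_self x⟩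
  simp only [Set.mem_ofPred_eq, h5, if_true] at h4
  by_contra hcon
  rw [if_neg] at h4
  · norm_num at h4
  · rintro ⟨u, hu⟩; exact hcon ⟨u, by simpa using hu⟩

lemma atom_unit {A : SA R} {x z : R} (h : z ∈ A.atom x) (u : Rˣ) : (u : R) * z ∈ A.atom (u * x) :=
  fun f hf => h _ (A.unit u f hf)

end SA

namespace AddSchurRing
section
variable {R : Type*} [AddCommGroup R] (A : AddSchurRing R)

noncomputable def cls (x : R) : Set R := (A.cover x).choose
lemma cls_mem (x : R) : A.cls x ∈ A.parts := (A.cover x).choose_spec.1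
lemma mem_cls (x : R) : x ∈ A.cls x := (A.cover x).choose_spec.2
lemma cls_eq {X : Set R} (hX : X ∈ A.parts) {x : R} (hx : x ∈ X) : A.cls x = X := by
  by_contra h
  have := A.disjoint _ (A.cls_mem x) _ hX h
  have h2 : x ∈ A.cls x ∩ X := ⟨A.mem_cls x, hx⟩
  rw [this] at h2; exact h2
lemma mem_iff_cls {X : Set R} (hX : X ∈ A.parts) (x : R) : x ∈ X ↔ A.cls x = X :=
  ⟨A.cls_eq hX, fun h => h ▸ A.mem_cls x⟩

/-- class functions -/
def Inv {k : Type*} (f : R → k) : Prop := ∀ x y, A.cls x = A.cls y → f x = f y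

lemma Inv.conv {k : Type*} [CommRing k] [Fintype R] {f g : R → k} (hf : A.Inv f) (hg : A.Inv g) :
    A.Inv (cv f g) := by
  classical
  haveI : Fintype (Set R) := Fintype.ofFinite _
  intro z₁ z₂ hz
  have key : ∀ z, cv f g z = ∑ p : Set R × Set R,
      ((Finset.univ.filter (fun x => (A.cls x, A.cls (z - x)) = p)).card : k) *
        ((if h : p.1.Nonempty then f h.choose else 0) * (if h : p.2.Nonempty then g h.choose else 0)) := by
    intro z
    unfold cv
    rw [← Finset.sum_fiberwise (s := Finset.univ) (g := fun x => (A.cls x, A.cls (z - x)))]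
    refine Finset.sum_congr rfl fun p _ => ?_
    rw [← nsmul_eq_mul, ← Finset.sum_const]
    refine Finset.sum_congr rfl fun x hx => ?_
    have hx := (Finset.mem_filter.mp hx).2
    subst hx
    have h1 : (A.cls x).Nonempty := ⟨x, A.mem_cls x⟩
    have h2 : (A.cls (z - x)).Nonempty := ⟨_, A.mem_cls _⟩
    simp only [h1, h2, dif_pos]
    congr 1
    · exact hf _ _ (A.cls_eq (A.cls_mem x) h1.choose_spec).symm
    · exact hg _ _ (A.cls_eq (A.cls_mem _) h2.choose_spec).symm
  have hcard : ∀ X ∈ A.parts, ∀ Y ∈ A.parts, ∀ z,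
      (Finset.univ.filter (fun x => (A.cls x, A.cls (z - x)) = (X, Y))).card =
      Set.ncard {xy : R × R | xy.1 ∈ X ∧ xy.2 ∈ Y ∧ xy.1 + xy.2 = z} := by
    intro X hX Y hY z
    rw [← Set.ncard_coe_finset]
    apply Set.ncard_congr (fun x _ => (x, z - x))
    · intro x hx
      simp only [Prod.mk.injEq, Finset.coe_filter, Finset.mem_univ, true_and, Set.mem_ofPred_eq] at hx ⊢
      rw [A.mem_iff_cls hX, A.mem_iff_cls hY]
      exact ⟨hx.1, hx.2, by simp⟩
    · intro a b _ _ h; exact (Prod.mk.inj h).1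
    · rintro ⟨a, b⟩ ⟨ha, hb, hab⟩
      simp only at ha hb hab
      refine ⟨a, ?_, by rw [← hab]; simp⟩
      simp only [Prod.mk.injEq, Finset.coe_filter, Finset.mem_univ, true_and, Set.mem_ofPred_eq]
      rw [← A.mem_iff_cls hX, ← A.mem_iff_cls hY, ← hab]
      exact ⟨ha, by simpa using hb⟩
  rw [key, key]
  refine Finset.sum_congr rfl fun p _ => ?_
  obtain ⟨X, Y⟩ := p
  by_cases hp : X ∈ A.parts ∧ Y ∈ A.parts
  · rw [hcard X hp.1 Y hp.2, hcard X hp.1 Y hp.2,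
      A.struct_const X hp.1 Y hp.2 _ (A.cls_mem z₁) z₁ (A.mem_cls z₁) z₂ (hz ▸ A.mem_cls z₂)]
  · have : ∀ z, (Finset.univ.filter (fun x => (A.cls x, A.cls (z - x)) = (X, Y))) = ∅ := by
      intro z
      apply Finset.filter_false_of_mem
      intro x _ h
      obtain ⟨h1, h2⟩ := Prod.mk.inj h
      exact hp ⟨h1 ▸ A.cls_mem x, h2 ▸ A.cls_mem _⟩
    rw [this, this]

end

section
variable {R : Type*} [CommRing R] (A : AddSchurRing R)

lemma cls_unit (hA : A.IsRingSRing) (u : Rˣ) {x y : R} (h : A.cls x = A.cls y) :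
    A.cls (u * x) = A.cls (u * y) := by
  have h1 := hA u _ (A.cls_mem x)
  rw [A.cls_eq h1 ⟨x, A.mem_cls x, rfl⟩, A.cls_eq h1 ⟨y, h ▸ A.mem_cls y, rfl⟩]

def toSA [Fintype R] (hA : A.IsRingSRing) : SA R where
  inv := {f | A.Inv f}
  comp2 φ f g hf hg := fun x y h => by simp only [hf x y h, hg x y h]
  conv f g hf hg := Inv.conv A hf hg
  unit u f hf := fun x y h => hf _ _ (A.cls_unit hA u h)
  zero := by
    classical
    refine ⟨fun x => if x = 0 then 1 else 0, ?_, fun x => by simp⟩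
    intro x y h
    have : ∀ x : R, x = 0 ↔ A.cls x = {0} := fun x => A.mem_iff_cls A.zero_mem x
    simp only [this, h]

lemma atom_eq [Fintype R] (hA : A.IsRingSRing) (x : R) : (A.toSA hA).atom x = A.cls x := by
  classical
  ext z
  constructor
  · intro h
    have := h (fun z => if A.cls z = A.cls x then 1 else 0) (fun a b hab => by simp only [hab])
    simp only [if_true] at this
    by_contra hcon
    rw [if_neg (fun h : A.cls z = A.cls x => hcon (h ▸ A.mem_cls z))] at this
    norm_num at this
  · intro h f hf
    exact hf _ _ (A.cls_eq (A.cls_mem x) h)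

end
end AddSchurRing


section fourier
variable {R : Type*} [CommRing R] [Fintype R]

/-- Fourier transform -/
noncomputable def FT (χ₀ : AddChar R ℂ) (F : R → ℂ) (r : R) : ℂ := ∑ x, F x * χ₀ (r * x)

open Classical in
/-- complex indicator -/
noncomputable def ci (S : Set R) (x : R) : ℂ := if x ∈ S then 1 else 0

variable {χ₀ : AddChar R ℂ}

lemma addChar_map_sum {ι : Type*} (s : Finset ι) (f : ι → R) :
    χ₀ (∑ i ∈ s, f i) = ∏ i ∈ s, χ₀ (f i) := by
  classical
  induction s using Finset.induction_on with
  | empty => simp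
  | insert a s ha ih => rw [Finset.sum_insert ha, Finset.prod_insert ha, AddChar.map_add_eq_mul, ih]

lemma sum_ci_ne (X : Set R) {u : R} (hu : u ∈ X) : ∑ r, ci X r ≠ 0 := by
  classical
  have hs : ∑ r, ci X r = ((Finset.univ.filter (fun x => x ∈ X)).card : ℂ) := by
    unfold ci
    rw [Finset.sum_boole]
  rw [hs]
  have : 0 < (Finset.univ.filter (fun x => x ∈ X)).card :=
    Finset.card_pos.mpr ⟨u, by simpa using hu⟩
  exact_mod_cast this.ne'

lemma FT_cv (F G : R → ℂ) (r : R) : FT χ₀ (cv F G) r = FT χ₀ F r * FT χ₀ G r := by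
  unfold FT cv
  rw [Finset.sum_mul_sum]
  simp_rw [Finset.sum_mul]
  rw [Finset.sum_comm]
  refine Finset.sum_congr rfl fun x _ => ?_
  symm
  apply Fintype.sum_equiv (Equiv.addLeft x)
  intro y
  simp only [Equiv.coe_addLeft, add_sub_cancel_left, mul_add, AddChar.map_add_eq_mul]
  ring

lemma finsum_FT (S : Set R) (r : R) : (∑ᶠ s ∈ S, (χ₀.mulShift r) s) = FT χ₀ (ci S) r := by
  classical
  rw [finsum_mem_def, finsum_eq_sum_of_fintype]
  unfold FT ci
  refine Finset.sum_congr rfl fun x _ => ?_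
  by_cases h : x ∈ S <;> simp [h, AddChar.mulShift_apply]

lemma prim_of_bij (h : Function.Bijective (fun r : R => χ₀.mulShift r)) : χ₀.IsPrimitive := by
  intro a ha hcon
  apply ha
  apply h.1
  simp only
  rw [hcon, AddChar.mulShift_zero]

lemma FT_inversion (h : χ₀.IsPrimitive) (F : R → ℂ) (y : R) :
    ∑ r, FT χ₀ F r * χ₀ (r * y) = Fintype.card R * F (-y) := by
  classical
  unfold FT
  simp_rw [Finset.sum_mul]
  rw [Finset.sum_comm]
  have : ∀ x : R, ∑ r : R, F x * χ₀ (r * x) * χ₀ (r * y)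
      = if x = -y then (Fintype.card R : ℂ) * F (-y) else 0 := by
    intro x
    simp_rw [mul_assoc, ← Finset.mul_sum, ← AddChar.map_add_eq_mul, ← mul_add]
    rw [AddChar.sum_mulShift _ h]
    by_cases hx : x = -y
    · rw [if_pos (by rw [hx]; simp), if_pos hx, hx, mul_comm]
    · rw [if_neg (fun h => hx (eq_neg_of_add_eq_zero_left h)), if_neg hx]; simp
  simp_rw [this]
  simp

lemma box (hCG : CGp R) (h : χ₀.IsPrimitive) (S : Set R)
    (hS : ∀ v : Rˣ, FT χ₀ (ci S) v = 0) (w : ℕ → R) (hw : ∀ q ∈ PP R, (q : R) * w q = 0) (y : R) :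
    ∑ Z ∈ (PP R).powerset, (-1 : ℂ) ^ Z.card * ci S (y + ∑ q ∈ Z, w q) = 0 := by
  classical
  have hc : (Fintype.card R : ℂ) ≠ 0 := by exact_mod_cast Fintype.card_ne_zero
  rw [← mul_right_inj' hc, mul_zero, Finset.mul_sum]
  have h1 : ∀ Z ∈ (PP R).powerset, (Fintype.card R : ℂ) * ((-1 : ℂ) ^ Z.card * ci S (y + ∑ q ∈ Z, w q))
      = ∑ r, FT χ₀ (ci S) r * χ₀ (r * (-y)) * ∏ q ∈ Z, (-χ₀ (r * (-w q))) := by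
    intro Z _
    rw [mul_left_comm]
    have h2 := FT_inversion h (ci S) (-(y + ∑ q ∈ Z, w q))
    rw [neg_neg] at h2
    rw [← h2, Finset.mul_sum]
    refine Finset.sum_congr rfl fun r _ => ?_
    rw [Finset.prod_neg, ← addChar_map_sum, neg_add, mul_add, AddChar.map_add_eq_mul,
      ← Finset.mul_sum, Finset.sum_neg_distrib]
    ring
  rw [Finset.sum_congr rfl h1, Finset.sum_comm]
  apply Finset.sum_eq_zero
  intro r _
  rw [← Finset.mul_sum, ← Finset.prod_one_add]
  by_cases hr : IsUnit r
  · obtain ⟨v, rfl⟩ := hr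
    rw [hS v]; simp
  · have : ∃ q ∈ PP R, (q : R) ∣ r := by
      by_contra hcon
      push Not at hcon
      exact hr (isUnit_of_forall hCG r hcon)
    obtain ⟨q, hq, t, rfl⟩ := this
    rw [Finset.prod_eq_zero hq, mul_zero]
    have : (q : R) * t * -w q = 0 := by linear_combination (-t) * hw q hq
    rw [this]; simp

lemma exists_ind (A : AddSchurRing R) (u : R) :
    ∃ F : R → ℂ, A.Inv F ∧ ∀ r, FT χ₀ F r =
      ci {r | ∀ S ∈ A.parts, FT χ₀ (ci S) r = FT χ₀ (ci S) u} r := by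
  classical
  set X : Set R := {r | ∀ S ∈ A.parts, FT χ₀ (ci S) r = FT χ₀ (ci S) u} with hX
  let 𝓕 : Set (R → ℂ) := {φ | ∃ F : R → ℂ, A.Inv F ∧ ∀ r, FT χ₀ F r = φ r}
  have hmul : ∀ φ ψ, φ ∈ 𝓕 → ψ ∈ 𝓕 → (fun r => φ r * ψ r) ∈ 𝓕 := by
    rintro φ ψ ⟨F, hF, hφ⟩ ⟨G, hG, hψ⟩
    exact ⟨cv F G, hF.conv A hG, fun r => by rw [FT_cv, hφ, hψ]⟩
  have hconst : ∀ c : ℂ, (fun _ => c) ∈ 𝓕 := by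
    intro c
    refine ⟨fun x => if x = 0 then c else 0, ?_, fun r => ?_⟩
    · intro x y h
      have : ∀ x : R, x = 0 ↔ A.cls x = {0} := fun x => A.mem_iff_cls A.zero_mem x
      simp only [this, h]
    · unfold FT; simp
  have hadd : ∀ φ ψ, φ ∈ 𝓕 → ψ ∈ 𝓕 → (fun r => φ r + ψ r) ∈ 𝓕 := by
    rintro φ ψ ⟨F, hF, hφ⟩ ⟨G, hG, hψ⟩
    refine ⟨fun x => F x + G x, fun x y h => by simp only [hF x y h, hG x y h], fun r => ?_⟩
    show _ = φ r + ψ r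
    rw [← hφ, ← hψ]
    unfold FT
    rw [← Finset.sum_add_distrib]
    exact Finset.sum_congr rfl fun x _ => by ring
  have hci : ∀ S ∈ A.parts, (fun r => FT χ₀ (ci S) r) ∈ 𝓕 := by
    intro S hS
    refine ⟨ci S, fun x y h => ?_, fun r => rfl⟩
    unfold ci
    simp only [A.mem_iff_cls hS, h]
  have hfac : ∀ r', ∃ φ ∈ 𝓕, r' ∉ X → (φ r' = 0 ∧ ∀ r ∈ X, φ r = 1) := by
    intro r'
    by_cases hr : r' ∈ X
    · exact ⟨_, hconst 0, fun h => absurd hr h⟩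
    · have h1 := hr
      rw [hX, Set.mem_ofPred_eq] at h1
      push Not at h1
      obtain ⟨S, hS, hne⟩ := h1
      refine ⟨_, hmul _ _ (hadd _ _ (hci S hS) (hconst (-FT χ₀ (ci S) r')))
        (hconst (FT χ₀ (ci S) u - FT χ₀ (ci S) r')⁻¹), fun _ => ⟨by simp, ?_⟩⟩
      intro r hrX
      have := hrX S hS
      rw [this, ← sub_eq_add_neg, mul_inv_cancel₀]
      exact sub_ne_zero.mpr (Ne.symm hne)
  choose φ hφ hφX using hfac
  have hprod : ∀ s : Finset R, (fun r => ∏ r' ∈ s, φ r' r) ∈ 𝓕 := by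
    intro s
    induction s using Finset.induction_on with
    | empty => simpa using hconst 1
    | insert a s ha ih =>
      have := hmul _ _ (hφ a) ih
      simpa only [Finset.prod_insert ha] using this
  obtain ⟨F, hF, hFr⟩ := hprod (Finset.univ.filter (fun r => r ∉ X))
  refine ⟨F, hF, fun r => ?_⟩
  rw [hFr]
  unfold ci
  by_cases hr : r ∈ X
  · rw [if_pos hr]
    apply Finset.prod_eq_one
    intro r' hr'
    exact (hφX r' (Finset.mem_filter.mp hr').2).2 r hr
  · rw [if_neg hr]
    exact Finset.prod_eq_zero (Finset.mem_filter.mpr ⟨Finset.mem_univ r, hr⟩) (hφX r hr).1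

lemma vanish (A : AddSchurRing R) (hA : A.IsRingSRing) (h : χ₀.IsPrimitive) (u : Rˣ) (I : Ideal R)
    (hI : I ≠ ⊥)
    (hXI : ∀ r ∈ {r | ∀ S ∈ A.parts, FT χ₀ (ci S) r = FT χ₀ (ci S) (u : R)}, ∀ i ∈ I,
      r + i ∈ {r | ∀ S ∈ A.parts, FT χ₀ (ci S) r = FT χ₀ (ci S) (u : R)}) :
    ∀ S ∈ A.parts, (∃ s ∈ S, IsUnit s) → ∀ v : Rˣ, FT χ₀ (ci S) (v : R) = 0 := by
  classical
  obtain ⟨F, hF, hFX⟩ := exists_ind (χ₀ := χ₀) A (u : R)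
  set X : Set R := {r | ∀ S ∈ A.parts, FT χ₀ (ci S) r = FT χ₀ (ci S) (u : R)} with hX
  have hc : (Fintype.card R : ℂ) ≠ 0 := by exact_mod_cast Fintype.card_ne_zero
  have hg : ∀ y, ∑ r, ci X r * χ₀ (r * y) = Fintype.card R * F (-y) := by
    intro y
    rw [← FT_inversion h]
    exact Finset.sum_congr rfl fun r _ => by rw [hFX]
  have hXI' : ∀ r, ∀ i ∈ I, ci X (r + i) = ci X r := by
    intro r i hi
    unfold ci
    by_cases hr : r ∈ X
    · rw [if_pos hr, if_pos (hXI r hr i hi)]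
    · rw [if_neg hr, if_neg]
      intro hh
      apply hr
      have := hXI _ hh (-i) (I.neg_mem hi)
      simpa using this
  have hg0 : ∀ s : Rˣ, F (-(s : R)) = 0 := by
    intro s
    obtain ⟨i₀, hi0, hne⟩ := Submodule.exists_mem_ne_zero_of_ne_bot hI
    have h1 := h hne
    obtain ⟨t, ht⟩ := (AddChar.ne_one_iff).mp h1
    rw [AddChar.mulShift_apply] at ht
    set i := i₀ * t * ((s⁻¹ : Rˣ) : R) with hi
    have hiI : i ∈ I := I.mul_mem_right _ (I.mul_mem_right _ hi0)
    have his : i * s = i₀ * t := by rw [hi, mul_assoc]; simp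
    have h2 : ∑ r, ci X r * χ₀ (r * s) = (∑ r, ci X r * χ₀ (r * s)) * χ₀ (i₀ * t) := by
      rw [Finset.sum_mul]
      symm
      apply Fintype.sum_equiv (Equiv.addRight i)
      intro r
      simp only [Equiv.coe_addRight]
      rw [hXI' r i hiI, add_mul, AddChar.map_add_eq_mul, his]; ring
    have h3 : (∑ r, ci X r * χ₀ (r * s)) * (χ₀ (i₀ * t) - 1) = 0 := by linear_combination -h2
    rcases mul_eq_zero.mp h3 with h4 | h4
    · rw [hg] at h4
      exact (mul_eq_zero.mp h4).resolve_left hc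
    · exact absurd (sub_eq_zero.mp h4) ht
  have huX : (u : R) ∈ X := fun S _ => rfl
  have main : ∀ S ∈ A.parts, (∃ s ∈ S, IsUnit s) → FT χ₀ (ci S) (u : R) = 0 := by
    rintro S hS ⟨_, hs, s, rfl⟩
    have h1 : ∀ x ∈ S, F (-x) = 0 := by
      intro x hx
      rw [← hg0 s]
      apply hF
      have := A.cls_unit hA (-1) (x := x) (y := s) (by rw [A.cls_eq hS hx, A.cls_eq hS hs])
      simpa using this
    have h2 : ∑ r, ci X r * FT χ₀ (ci S) r = 0 := by
      unfold FT
      simp_rw [Finset.mul_sum]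
      rw [Finset.sum_comm]
      apply Finset.sum_eq_zero
      intro x _
      have : ∀ r, ci X r * (ci S x * χ₀ (r * x)) = ci S x * (ci X r * χ₀ (r * x)) := fun r => by ring
      simp_rw [this]
      rw [← Finset.mul_sum, hg]
      by_cases hx : x ∈ S
      · rw [h1 x hx]; simp
      · unfold ci; rw [if_neg hx]; simp
    have h3 : ∀ r, ci X r * FT χ₀ (ci S) r = ci X r * FT χ₀ (ci S) (u : R) := by
      intro r
      by_cases hr : r ∈ X
      · rw [hr S hS]
      · unfold ci; rw [if_neg hr]; simp
    simp_rw [h3] at h2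
    rw [← Finset.sum_mul] at h2
    refine (mul_eq_zero.mp h2).resolve_left ?_
    exact sum_ci_ne X huX
  rintro S hS ⟨_, hs, s, rfl⟩ v
  have h1 := hA (u⁻¹ * v) S hS
  have h2 := main _ h1 ⟨_, ⟨s, hs, rfl⟩, (u⁻¹ * v * s).isUnit⟩
  rw [← h2]
  unfold FT
  apply Fintype.sum_equiv (Units.mulLeft (u⁻¹ * v))
  intro x
  simp only [Units.mulLeft_apply]
  have h3 : (u : R) * (((u⁻¹ * v : Rˣ) : R) * x) = v * x := by
    rw [← mul_assoc, ← Units.val_mul]; simp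
  have h4 : ci ((fun x : R => ((u⁻¹ * v : Rˣ) : R) * x) '' S) (((u⁻¹ * v : Rˣ) : R) * x) = ci S x := by
    unfold ci
    have : ((u⁻¹ * v : Rˣ) : R) * x ∈ ((fun x : R => ((u⁻¹ * v : Rˣ) : R) * x) '' S) ↔ x ∈ S := by
      constructor
      · rintro ⟨z, hz, hzx⟩
        have := (Units.mul_right_inj _).mp hzx
        rwa [← this]
      · intro hx; exact ⟨x, hx, rfl⟩
    simp only [this]
  rw [h3, h4]

end fourier


lemma alt_sum {β : Type*} [DecidableEq β] (P : Finset ℕ) (b : ℕ → β) (c : Finset ℕ → ℂ)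
    (hc1 : ∀ Z ⊆ P, (∀ q ∈ P, ∃ r ∈ P, b r = b q ∧ r ∉ Z) → c Z = 1)
    (hc0 : ∀ Z ⊆ P, (¬ ∀ q ∈ P, ∃ r ∈ P, b r = b q ∧ r ∉ Z) → c Z = 0) :
    ∑ Z ∈ P.powerset, (-1 : ℂ) ^ Z.card * c Z ≠ 0 := by
  classical
  have h1 : ∀ Z ∈ P.powerset, (-1 : ℂ) ^ Z.card * c Z = ∑ J ∈ (P.image b).powerset,
      (-1 : ℂ) ^ J.card * ((-1 : ℂ) ^ Z.card * if ∀ i ∈ J, ∀ r ∈ P, b r = i → r ∈ Z then 1 else 0) := by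
    intro Z hZ
    rw [Finset.mem_powerset] at hZ
    have h2 : c Z = ∏ i ∈ P.image b, (1 + -(if ∀ r ∈ P, b r = i → r ∈ Z then (1 : ℂ) else 0)) := by
      by_cases h : ∀ q ∈ P, ∃ r ∈ P, b r = b q ∧ r ∉ Z
      · rw [hc1 Z hZ h]
        symm
        apply Finset.prod_eq_one
        intro i hi
        obtain ⟨q, hq, rfl⟩ := Finset.mem_image.mp hi
        obtain ⟨r, hr, hb, hrZ⟩ := h q hq
        rw [if_neg (fun h => hrZ (h r hr hb))]; simp
      · rw [hc0 Z hZ h]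
        push Not at h
        obtain ⟨q, hq, h⟩ := h
        rw [Finset.prod_eq_zero (Finset.mem_image_of_mem b hq)]
        rw [if_pos h]; simp
    rw [h2, Finset.prod_one_add, Finset.mul_sum]
    refine Finset.sum_congr rfl fun J _ => ?_
    rw [Finset.prod_neg, Finset.prod_ite_zero, Finset.prod_const_one]
    ring
  rw [Finset.sum_congr rfl h1, Finset.sum_comm]
  have h3 : ∀ J ∈ (P.image b).powerset, ∑ Z ∈ P.powerset,
      (-1 : ℂ) ^ J.card * ((-1 : ℂ) ^ Z.card * if ∀ i ∈ J, ∀ r ∈ P, b r = i → r ∈ Z then 1 else 0)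
      = (-1 : ℂ) ^ J.card * ∏ q ∈ P, ((-1 : ℂ) + if b q ∉ J then 1 else 0) := by
    intro J _
    rw [← Finset.mul_sum, Finset.prod_add]
    congr 1
    refine Finset.sum_congr rfl fun Z hZ => ?_
    rw [Finset.prod_const, Finset.prod_ite_zero, Finset.prod_const_one]
    congr 2
    simp only [Finset.mem_sdiff, eq_iff_iff]
    constructor
    · intro h q hq hJ; exact hq.2 (h _ hJ q hq.1 rfl)
    · rintro h _ hJ r hr rfl
      by_contra hcon
      exact h r ⟨hr, hcon⟩ hJ
  rw [Finset.sum_congr rfl h3, Finset.sum_eq_single (P.image b)]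
  · have : ∏ q ∈ P, ((-1 : ℂ) + if b q ∉ P.image b then 1 else 0) = ∏ q ∈ P, (-1 : ℂ) := by
      refine Finset.prod_congr rfl fun q hq => ?_
      rw [if_neg (not_not.mpr (Finset.mem_image_of_mem b hq)), add_zero]
    rw [this, Finset.prod_const]
    simp
  · intro J hJ hne
    rw [Finset.mem_powerset] at hJ
    have : ∃ q ∈ P, b q ∉ J := by
      by_contra hcon
      push Not at hcon
      apply hne
      apply Finset.Subset.antisymm hJ
      intro i hi
      obtain ⟨q, hq, rfl⟩ := Finset.mem_image.mp hi
      exact hcon q hq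
    obtain ⟨q, hq, hqJ⟩ := this
    rw [Finset.prod_eq_zero hq, mul_zero]
    rw [if_pos hqJ]; simp
  · intro h; exact absurd (Finset.mem_powerset_self _) h

namespace SA
variable {R : Type*} [CommRing R] [Fintype R] {A : SA R} {e : ℕ → R} {k : ℕ → ℕ}

lemma atom_eq_of_mem {x z : R} (h : z ∈ A.atom x) : A.atom z = A.atom x := by
  ext w
  exact ⟨fun hw => atom_trans hw h, fun hw => atom_trans hw (atom_symm h)⟩

lemma stab {c x : R} {v : Rˣ} (hx : x ∈ A.atom c) (hv : (v : R) * x ∈ A.atom c) {z : R}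
    (hz : z ∈ A.atom c) : (v : R) * z ∈ A.atom c :=
  atom_trans (atom_unit (atom_trans hz (atom_symm hx)) v) hv

/-- purity in terms of atoms -/
def Pur (A : SA R) : Prop := ∀ c, A.Gen c → ∀ q ∈ PP R,
  ∃ x ∈ A.atom c, ∃ w : R, (q : R) * w = 0 ∧ x + w ∉ A.atom c

lemma qinv_atom (hCG : CGp R) {E : R} {c : R} (hc : A.Gen c) (h1 : A.Gen (1 - E)) :
    QInv E (A.atom c) := by
  intro v hv x hx
  obtain ⟨u₁, hu₁⟩ := gen_unit hCG A h1
  obtain ⟨u₂, hu₂⟩ := gen_unit hCG A hc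
  have h2 : (v : R) * (1 - E) ∈ A.atom (1 - E) := by
    rw [mul_comm, hv]; exact mem_atom_self _
  have h3 := stab (mem_atom_self _) h2 hu₁
  rw [← atom_eq_of_mem hu₁] at h3
  have h4 := atom_unit h3 (u₂ * u₁⁻¹)
  have h5 : ((u₂ * u₁⁻¹ : Rˣ) : R) * ((v : R) * u₁) = v * u₂ := by
    rw [← Units.val_mul, ← Units.val_mul, ← Units.val_mul]; congr 1
    rw [mul_comm v, ← mul_assoc, inv_mul_cancel_right, mul_comm]
  have h6 : ((u₂ * u₁⁻¹ : Rˣ) : R) * (u₁ : R) = u₂ := by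
    rw [← Units.val_mul]; simp
  rw [h5, h6, atom_eq_of_mem hu₂] at h4
  exact stab hu₂ h4 hx

lemma EE_nongen (hCG : CGp R) {q : ℕ} (hq : q ∈ PP R) (H : QD q (e q) (k q)) {c : R} (hc : A.Gen c)
    (h1 : A.Gen (1 - e q)) {z : R} (hz : z ∈ EE (e q) ((q : R) ^ (k q - 1) * e q) (A.atom c)) :
    ¬ A.Gen z := by
  intro hg
  have hE := aset_EE (mem_PP.mp hq).1 H (A.aset_atom c) (qinv_atom hCG hc h1)
  obtain ⟨u, hu⟩ := gen_unit hCG A hg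
  have := (hE.atom_subset hz hu).1
  exact H.e_ne (by simpa using this)

lemma exists_EE (hCG : CGp R) (hP : A.Pur) {q : ℕ} (hq : q ∈ PP R) (H : QD q (e q) (k q))
    (h1 : A.Gen (1 - e q)) :
    ∃ z, ¬ A.Gen z ∧ A.Gen (z + (q : R) ^ (k q - 1) * e q) := by
  have hI := qinv_atom hCG (gen_one A) h1
  have hne : (EE (e q) ((q : R) ^ (k q - 1) * e q) (A.atom 1)).Nonempty := by
    by_contra hcon
    rw [Set.not_nonempty_iff_eq_empty] at hcon
    obtain ⟨x, hx, w, hw, hxw⟩ := hP 1 (gen_one A) q hq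
    exact hxw (EE_empty H hI hcon hx hw)
  obtain ⟨z, hz⟩ := hne
  have hng := EE_nongen hCG hq H (gen_one A) h1 hz
  have hz1 : z ∉ A.atom 1 := fun h => hng ((gen_one A).atom h)
  refine ⟨z, hng, (gen_one A).atom ?_⟩
  by_contra hcon
  exact hz.2 (iff_of_false hz1 hcon)

lemma shift (hCG : CGp R) {q : ℕ} (hq : q ∈ PP R) (H : QD q (e q) (k q)) {c : R} (hc : A.Gen c)
    (h1 : A.Gen (1 - e q)) {x : R} (hx : A.Gen x) (hex : e q * x = 0) :
    x ∈ A.atom c ↔ x + (q : R) ^ (k q - 1) * e q ∈ A.atom c := by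
  by_contra hcon
  exact EE_nongen hCG hq H hc h1 ⟨hex, hcon⟩ hx

/-- maximal proper `A`-ideals -/
def MaxA (A : SA R) (M : Ideal R) : Prop :=
  A.ASet (M : Set R) ∧ M ≠ ⊤ ∧ ∀ N : Ideal R, A.ASet (N : Set R) → M ≤ N → N ≠ ⊤ → N ≤ M

lemma not_gen {x : R} (hx : ¬ A.Gen x) : ∃ M, A.MaxA M ∧ x ∈ M := by
  unfold Gen at hx
  push Not at hx
  obtain ⟨V, hV, hxV, hVt⟩ := hx
  obtain ⟨M, hVM, ⟨h1, h2⟩, h3⟩ := (Set.toFinite {N : Ideal R | A.ASet (N : Set R) ∧ N ≠ ⊤}).exists_le_maximal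
    (a := V) ⟨hV, hVt⟩
  exact ⟨M, ⟨h1, h2, fun N hN hMN hNt => h3 ⟨hN, hNt⟩ hMN⟩, hVM hxV⟩

lemma Gen.notMem {x : R} (hx : A.Gen x) {M : Ideal R} (hM : A.MaxA M) : x ∉ M :=
  fun h => hM.2.1 (hx M hM.1 h)

lemma max_unique {q : ℕ} (H : QD q (e q) (k q)) {M N : Ideal R} (hM : A.MaxA M)
    (hN : A.MaxA N) (h1 : e q ∉ M) (h2 : e q ∉ N) : M = N := by
  by_contra hne
  have htop : M ⊔ N = ⊤ := by
    by_contra hcon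
    have h3 := hM.2.2 _ (aset_sup hM.1 hN.1) le_sup_left hcon
    have h4 := hN.2.2 _ (aset_sup hM.1 hN.1) le_sup_right hcon
    exact hne (le_antisymm (le_sup_left.trans h4) (le_sup_right.trans h3))
  have h5 : (1 : R) ∈ M ⊔ N := by rw [htop]; trivial
  obtain ⟨m, hm, n, hn, hmn⟩ := Submodule.mem_sup.mp h5
  have key : ∀ J : Ideal R, e q ∉ J → ∀ m ∈ J, ∃ t, e q * m = q * e q * t := by
    intro J hJ m hm
    obtain ⟨b, u, hu, hb⟩ := H.val m
    rcases b with _ | b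
    · exfalso; apply hJ
      have : e q = (e q * ((u⁻¹ : Rˣ) : R)) * m := by
        have h6 : (u : R) * ((u⁻¹ : Rˣ) : R) = 1 := by simp
        simp only [pow_zero, one_mul] at hb
        linear_combination (-((u⁻¹ : Rˣ) : R)) * hb - e q * h6
      rw [this]; exact J.mul_mem_left _ hm
    · exact ⟨(q : R) ^ b * u, by rw [hb]; ring⟩
  obtain ⟨t, ht⟩ := key M h1 m hm
  obtain ⟨s, hs⟩ := key N h2 n hn
  obtain ⟨v, hv⟩ := unit_of_nilp H.idem H.kill (-(t + s))
  have : (v : R) * e q = 0 := by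
    rw [hv]; linear_combination (-(e q)) * hmn + ht + hs - (q * (t + s)) * H.idem
  exact H.e_ne (by simpa using this)

lemma exists_max (hCG : CGp R) (hP : A.Pur) {q : ℕ} (hq : q ∈ PP R) (H : QD q (e q) (k q)) :
    ∃ M, A.MaxA M ∧ e q ∉ M := by
  by_contra hcon
  push Not at hcon
  have h1 : A.Gen (1 - e q) := by
    by_contra h
    obtain ⟨M, hM, hx⟩ := not_gen h
    apply hM.2.1
    rw [Ideal.eq_top_iff_one]
    have := M.add_mem hx (hcon M hM)
    simpa using this
  obtain ⟨z, hz, hzy⟩ := exists_EE hCG hP hq H h1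
  obtain ⟨M, hM, hzM⟩ := not_gen hz
  exact hzy.notMem hM (M.add_mem hzM (M.mul_mem_left _ (hcon M hM)))

end SA


lemma pow_one_of_nilp {R : Type*} [CommRing R] {q : ℕ} {e : R} {k : ℕ} (H : QD q e k)
    (v : Rˣ) (t : R) (hv : (v : R) = 1 + q * e * t) : v ^ (q ^ k) = 1 := by
  have h1 : (q : R) ∣ (v : R) - 1 := ⟨e * t, by rw [hv]; ring⟩
  obtain ⟨s, hs⟩ := dvd_sub_pow_of_dvd_sub h1 k
  have h2 : ∀ n : ℕ, (1 - e) * (v : R) ^ n = 1 - e := by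
    intro n
    induction n with
    | zero => simp
    | succ n ih =>
      rw [pow_succ, ← mul_assoc, ih, hv]
      linear_combination (-(q : R) * t) * H.idem
  have h3 := h2 (q ^ k)
  ext
  rw [Units.val_pow_eq_pow_val, Units.val_one]
  rw [one_pow] at hs
  have h4 := H.kill
  rw [pow_succ] at hs
  linear_combination h3 + e * hs + q * s * h4

namespace SA
variable {R : Type*} [CommRing R] [Fintype R] {A : SA R} {e : ℕ → R} {k : ℕ → ℕ} {b : ℕ → Ideal R}

lemma gen_iff (H : ∀ q ∈ PP R, QD q (e q) (k q)) (hb : ∀ q ∈ PP R, A.MaxA (b q) ∧ e q ∉ b q)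
    {x : R} : A.Gen x ↔ ∀ q ∈ PP R, ∃ r ∈ PP R, b r = b q ∧ e r * x ∉ b q := by
  constructor
  · intro hx q hq
    have h1 := hx.notMem (hb q hq).1
    rw [mem_ideal_iff_e H] at h1
    push Not at h1
    obtain ⟨r, hr, h2⟩ := h1
    refine ⟨r, hr, ?_, h2⟩
    exact max_unique (H r hr) (hb r hr).1 (hb q hq).1 (hb r hr).2
      (fun h => h2 ((b q).mul_mem_right _ h))
  · intro h
    by_contra hx
    obtain ⟨M, hM, hxM⟩ := not_gen hx
    have h1 : ∃ q ∈ PP R, e q ∉ M := by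
      by_contra hcon
      push Not at hcon
      exact hM.2.1 (ideal_top_of_e H M hcon)
    obtain ⟨q, hq, h1⟩ := h1
    have h2 : M = b q := max_unique (H q hq) hM (hb q hq).1 h1 (hb q hq).2
    obtain ⟨r, hr, -, h3⟩ := h q hq
    exact h3 (h2 ▸ M.mul_mem_left _ hxM)

lemma gen_one_sub (H : ∀ q ∈ PP R, QD q (e q) (k q))
    (hb : ∀ q ∈ PP R, A.MaxA (b q) ∧ e q ∉ b q) {q r : ℕ} (hq : q ∈ PP R) (hr : r ∈ PP R)
    (hne : r ≠ q) (hbr : b r = b q) : A.Gen (1 - e q) := by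
  rw [gen_iff H hb]
  intro s hs
  by_cases h : b s = b q
  · refine ⟨r, hr, hbr.trans h.symm, ?_⟩
    rw [mul_sub, mul_one, orth H hr hq hne, sub_zero, h, ← hbr]
    exact (hb r hr).2
  · refine ⟨s, hs, rfl, ?_⟩
    have : s ≠ q := by rintro rfl; exact h rfl
    rw [mul_sub, mul_one, orth H hs hq this, sub_zero]
    exact (hb s hs).2

lemma y_notMem (hCG : CGp R) (hP : A.Pur) (H : ∀ q ∈ PP R, QD q (e q) (k q))
    (hb : ∀ q ∈ PP R, A.MaxA (b q) ∧ e q ∉ b q) {q r : ℕ} (hq : q ∈ PP R) (hr : r ∈ PP R)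
    (hne : r ≠ q) (hbr : b r = b q) : (q : R) ^ (k q - 1) * e q ∉ b q := by
  have h1 := gen_one_sub H hb hq hr hne hbr
  obtain ⟨z, hz, hzy⟩ := exists_EE hCG hP hq (H q hq) h1
  obtain ⟨M, hM, hzM⟩ := not_gen hz
  have h2 : (q : R) ^ (k q - 1) * e q ∉ M := fun h => hzy.notMem hM (M.add_mem hzM h)
  have h3 : M = b q := max_unique (H q hq) hM (hb q hq).1
    (fun h => h2 (M.mul_mem_left _ h)) (hb q hq).2
  rwa [← h3]

lemma exists_v (hP : A.Pur) (H : ∀ q ∈ PP R, QD q (e q) (k q))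
    (hb : ∀ q ∈ PP R, A.MaxA (b q) ∧ e q ∉ b q) {q : ℕ} (hq : q ∈ PP R)
    (hs : ∀ r ∈ PP R, b r = b q → r = q) {a : ℕ} (ha : 1 ≤ a) (hak : a < k q)
    (hab : (q : R) ^ a * e q ∈ b q) {y : R} (hy : A.Gen y) (hey : e q * y = (q : R) ^ (a - 1) * e q) :
    ∃ v : Rˣ, ∃ t : R, (v : R) = 1 + q * e q * t ∧ (q : R) * (v * y - y) = 0 ∧
      (v : R) * y ∉ A.atom y := by
  by_contra hcon
  push Not at hcon
  obtain ⟨x, hx, w, hw, hxw⟩ := hP y hy q hq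
  have hgx := hy.atom hx
  obtain ⟨r, hr, hbr, hrx⟩ := (gen_iff H hb).mp hgx q hq
  obtain rfl := hs r hr hbr
  obtain ⟨β, u, hu, hβ⟩ := (H r hr).val x
  have hβa : β < a := by
    by_contra h
    apply hrx
    have : e r * x = ((r : R) ^ (β - a) * u) * ((r : R) ^ a * e r) := by
      have h2 : (r : R) ^ β = (r : R) ^ (β - a) * (r : R) ^ a := by
        rw [← pow_add]; congr 1; omega
      rw [hβ, h2]; ring
    rw [this]
    exact (b r).mul_mem_left _ hab
  obtain ⟨t, ht⟩ := (H r hr).kill_form' hw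
  obtain ⟨v, hv⟩ := unit_of_nilp (H r hr).idem (H r hr).kill
    ((r : R) ^ (k r - 2 - β) * ((u⁻¹ : Rˣ) : R) * t)
  have h1 := hcon v _ hv ?_
  · apply hxw
    have h2 := stab (mem_atom_self y) h1 hx
    have h3 : x + w = v * x := by
      have h2 : (r : R) ^ (k r - 1) = (r : R) ^ (k r - 2 - β) * (r : R) ^ β * r := by
        rw [← pow_add, ← pow_succ]; congr 1; omega
      have h3 : (u : R) * (u⁻¹ : Rˣ) = 1 := by simp
      rw [hv, ht, h2]
      linear_combination (-(r : R) * ((r : R) ^ (k r - 2 - β) * (u⁻¹ : Rˣ) * t)) * hβ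
        - (r : R) ^ (k r - 2 - β) * (r : R) ^ β * r * e r * t * h3
    rwa [h3]
  · have h2 : (r : R) ^ (k r) * e r = 0 := (H r hr).kill
    have h4 : (r : R) ^ (a - 1 - β) * (r : R) ^ (k r) =
        r * (r * (r : R) ^ (k r - 2 - β) * (r : R) ^ (a - 1)) := by
      rw [← pow_add, ← pow_succ', ← pow_add, ← pow_succ']; congr 1; omega
    rw [hv]
    linear_combination (r * r * ((r : R) ^ (k r - 2 - β) * ((u⁻¹ : Rˣ) : R) * t)) * hey
      + ((u⁻¹ : Rˣ) : R) * t * (r : R) ^ (a - 1 - β) * h2 - ((u⁻¹ : Rˣ) : R) * t * e r * h4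

structure Cfg (A : SA R) (e : ℕ → R) (k : ℕ → ℕ) (b : ℕ → Ideal R) (y : R) (w : ℕ → R)
    (v : ℕ → Rˣ) (p : ℕ → Prop) : Prop where
  hCG : CGp R
  H : ∀ q ∈ PP R, QD q (e q) (k q)
  hb : ∀ q ∈ PP R, A.MaxA (b q) ∧ e q ∉ b q
  ny : ∀ q ∈ PP R, e q * y ∉ b q
  ew : ∀ q ∈ PP R, e q * w q = w q
  p0 : ∀ q ∈ PP R, p q → e q * y = (q : R) ^ (k q - 1) * e q ∧ w q = -((q : R) ^ (k q - 1) * e q)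
  p1 : ∀ q ∈ PP R, ¬ p q → (v q : R) * y = y + w q ∧ (v q : R) * y ∉ A.atom y ∧
    (∀ r ∈ PP R, b r = b q → r = q) ∧ (v q) ^ (q ^ k q) = 1 ∧ (v q : R) * (1 - e q) = 1 - e q

namespace Cfg
variable {y : R} {w : ℕ → R} {v : ℕ → Rˣ} {p : ℕ → Prop}

lemma gy (C : Cfg A e k b y w v p) : A.Gen y := by
  rw [gen_iff C.H C.hb]
  intro q hq
  exact ⟨q, hq, rfl, C.ny q hq⟩

lemma e_sum (C : Cfg A e k b y w v p) {Z : Finset ℕ} (hZ : Z ⊆ PP R) {r : ℕ} (hr : r ∈ PP R) :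
    e r * ∑ q ∈ Z, w q = if r ∈ Z then w r else 0 := by
  classical
  have : ∀ q ∈ Z, e r * w q = if q = r then w r else 0 := by
    intro q hq
    split_ifs with h
    · subst h; exact C.ew q hr
    · rw [← C.ew q (hZ hq), ← mul_assoc, orth C.H hr (hZ hq) (Ne.symm h), zero_mul]
  rw [Finset.mul_sum, Finset.sum_congr rfl this, Finset.sum_ite_eq']

lemma gen_corner (C : Cfg A e k b y w v p) {Z : Finset ℕ} (hZ : Z ⊆ PP R) :
    A.Gen (y + ∑ q ∈ Z, w q) ↔ ∀ q ∈ PP R, ∃ r ∈ PP R, b r = b q ∧ ¬ (r ∈ Z ∧ p r) := by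
  rw [gen_iff C.H C.hb]
  refine forall₂_congr fun q hq => exists_congr fun r => and_congr_right fun hr =>
    and_congr_right fun hbr => not_congr ?_
  rw [← hbr, mul_add, C.e_sum hZ hr]
  constructor
  · intro h
    by_contra hcon
    by_cases hrZ : r ∈ Z
    · have hp : ¬ p r := fun hp => hcon ⟨hrZ, hp⟩
      rw [if_pos hrZ, ← C.ew r hr, ← mul_add, ← (C.p1 r hr hp).1] at h
      apply C.ny r hr
      have := (b r).mul_mem_left (((v r)⁻¹ : Rˣ) : R) h
      rwa [mul_left_comm (e r), Units.inv_mul_cancel_left] at this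
    · rw [if_neg hrZ, add_zero] at h
      exact C.ny r hr h
  · rintro ⟨h1, h2⟩
    rw [if_pos h1, (C.p0 r hr h2).1, (C.p0 r hr h2).2, add_neg_cancel]
    exact (b r).zero_mem

lemma rem (C : Cfg A e k b y w v p) {Z : Finset ℕ} (hZ : Z ⊆ PP R)
    (hg : A.Gen (y + ∑ q ∈ Z, w q)) {q : ℕ} (hq : q ∈ Z) (hp : p q) :
    A.Gen (y + ∑ q ∈ Z.erase q, w q) ∧
    (y + ∑ q ∈ Z, w q ∈ A.atom y ↔ y + ∑ q ∈ Z.erase q, w q ∈ A.atom y) := by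
  have hqP := hZ hq
  have hg' := (C.gen_corner hZ).mp hg
  constructor
  · rw [C.gen_corner ((Finset.erase_subset _ _).trans hZ)]
    intro s hs
    obtain ⟨r, hr, h1, h2⟩ := hg' s hs
    exact ⟨r, hr, h1, fun h => h2 ⟨Finset.mem_of_mem_erase h.1, h.2⟩⟩
  · obtain ⟨r, hr, h1, h2⟩ := hg' q hqP
    have hne : r ≠ q := by rintro rfl; exact h2 ⟨hq, hp⟩
    have h3 := gen_one_sub C.H C.hb hqP hr hne h1
    have h4 : e q * (y + ∑ q ∈ Z, w q) = 0 := by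
      rw [mul_add, C.e_sum hZ hqP, if_pos hq, (C.p0 q hqP hp).1, (C.p0 q hqP hp).2, add_neg_cancel]
    rw [shift C.hCG hqP (C.H q hqP) C.gy h3 hg h4, ← Finset.add_sum_erase _ _ hq,
      (C.p0 q hqP hp).2]
    have h5 : y + (-((q : R) ^ (k q - 1) * e q) + ∑ x ∈ Z.erase q, w x) + (q : R) ^ (k q - 1) * e q
      = y + ∑ x ∈ Z.erase q, w x := by ring
    rw [h5]

lemma remAll [DecidablePred p] (C : Cfg A e k b y w v p) (n : ℕ) : ∀ {Z : Finset ℕ}, Z.card = n → Z ⊆ PP R →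
    A.Gen (y + ∑ q ∈ Z, w q) →
    (y + ∑ q ∈ Z, w q ∈ A.atom y ↔ y + ∑ q ∈ Z with ¬ p q, w q ∈ A.atom y) := by
  induction n with
  | zero =>
    intro Z hc hZ hg
    rw [Finset.card_eq_zero] at hc
    subst hc; simp
  | succ n ih =>
    intro Z hc hZ hg
    by_cases h : ∃ q ∈ Z, p q
    · obtain ⟨q, hq, hp⟩ := h
      obtain ⟨h1, h2⟩ := C.rem hZ hg hq hp
      rw [h2, ih (by rw [Finset.card_erase_of_mem hq, hc]; rfl)
        ((Finset.erase_subset _ _).trans hZ) h1]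
      have : (Z.erase q).filter (fun q => ¬ p q) = Z.filter (fun q => ¬ p q) := by
        ext s
        simp only [Finset.mem_filter, Finset.mem_erase]
        constructor
        · rintro ⟨⟨-, h⟩, h'⟩; exact ⟨h, h'⟩
        · rintro ⟨h, h'⟩; exact ⟨⟨by rintro rfl; exact h' hp, h⟩, h'⟩
      rw [this]
    · push Not at h
      rw [Finset.filter_true_of_mem h]

lemma prod_v (C : Cfg A e k b y w v p) {Z : Finset ℕ} (hZ : Z ⊆ PP R) (hp : ∀ q ∈ Z, ¬ p q) :
    ((∏ q ∈ Z, v q : Rˣ) : R) * y = y + ∑ q ∈ Z, w q := by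
  classical
  induction Z using Finset.induction_on with
  | empty => simp
  | insert a s ha ih =>
    have ih := ih (fun q hq => hZ (Finset.mem_insert_of_mem hq)) (fun q hq => hp q (Finset.mem_insert_of_mem hq))
    have haP := hZ (Finset.mem_insert_self a s)
    have h1 := C.p1 a haP (hp a (Finset.mem_insert_self a s))
    rw [Finset.prod_insert ha, Finset.sum_insert ha, Units.val_mul, mul_assoc, ih, mul_add, h1.1]
    have h2 : (v a : R) * ∑ q ∈ s, w q = ∑ q ∈ s, w q := by
      have h3 := C.e_sum (fun q hq => hZ (Finset.mem_insert_of_mem hq) : s ⊆ PP R) haP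
      rw [if_neg ha] at h3
      have h4 := h1.2.2.2.2
      linear_combination (v a - 1 : R) * h3 + (∑ q ∈ s, w q) * h4
    rw [h2, add_assoc]

lemma v_mem (C : Cfg A e k b y w v p) {Z : Finset ℕ} (hZ : Z ⊆ PP R) (hp : ∀ q ∈ Z, ¬ p q)
    (hm : ((∏ q ∈ Z, v q : Rˣ) : R) * y ∈ A.atom y) {r : ℕ} (hr : r ∈ Z) :
    (v r : R) * y ∈ A.atom y := by
  classical
  have hpow : ∀ (g : Rˣ), (g : R) * y ∈ A.atom y → ∀ n : ℕ, ((g ^ n : Rˣ) : R) * y ∈ A.atom y := by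
    intro g hg n
    induction n with
    | zero => simpa using mem_atom_self y
    | succ n ih =>
      rw [pow_succ', Units.val_mul, mul_assoc]
      exact stab (mem_atom_self y) hg ih
  set n := ∏ s ∈ Z.erase r, s ^ k s with hn
  have h1 : (∏ q ∈ Z, v q) ^ n = v r ^ n := by
    rw [← Finset.mul_prod_erase _ _ hr, mul_pow, ← Finset.prod_pow, Finset.prod_eq_one, mul_one]
    intro s hs
    have hsZ := Finset.mem_of_mem_erase hs
    obtain ⟨m, hm⟩ : s ^ k s ∣ n := Finset.dvd_prod_of_mem _ hs
    rw [hm, pow_mul, (C.p1 s (hZ hsZ) (hp s hsZ)).2.2.2.1, one_pow]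
  have h2 : n.Coprime (r ^ k r) := by
    rw [hn]
    apply Nat.Coprime.prod_left
    intro s hs
    apply Nat.Coprime.pow
    exact (Nat.coprime_primes (mem_PP.mp (hZ (Finset.mem_of_mem_erase hs))).1 (mem_PP.mp (hZ hr)).1).mpr
      (Finset.ne_of_mem_erase hs)
  have h3 : n.Coprime (orderOf (v r)) :=
    h2.coprime_dvd_right (orderOf_dvd_of_pow_eq_one (C.p1 r (hZ hr) (hp r hr)).2.2.2.1)
  obtain ⟨m, hm'⟩ := exists_pow_eq_self_of_coprime h3
  have h4 := hpow _ (hpow _ hm n) m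
  rwa [h1, hm'] at h4

lemma corner_iff (C : Cfg A e k b y w v p) {Z : Finset ℕ} (hZ : Z ⊆ PP R) :
    y + ∑ q ∈ Z, w q ∈ A.atom y ↔ ∀ q ∈ PP R, ∃ r ∈ PP R, b r = b q ∧ r ∉ Z := by
  classical
  constructor
  · intro hm
    by_contra hcon
    push Not at hcon
    obtain ⟨q, hq, hcon⟩ := hcon
    have hg := C.gy.atom hm
    obtain ⟨r, hr, h1, h2⟩ := (C.gen_corner hZ).mp hg q hq
    have hrZ := hcon r hr h1
    have hpr : ¬ p r := fun h => h2 ⟨hrZ, h⟩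
    rw [C.remAll _ rfl hZ hg, ← C.prod_v ((Finset.filter_subset _ _).trans hZ)
      (fun q hq => (Finset.mem_filter.mp hq).2)] at hm
    exact (C.p1 r hr hpr).2.1 (C.v_mem ((Finset.filter_subset _ _).trans hZ)
      (fun q hq => (Finset.mem_filter.mp hq).2) hm (Finset.mem_filter.mpr ⟨hrZ, hpr⟩))
  · intro h
    have hg : A.Gen (y + ∑ q ∈ Z, w q) := by
      rw [C.gen_corner hZ]
      intro q hq
      obtain ⟨r, hr, h1, h2⟩ := h q hq
      exact ⟨r, hr, h1, fun h => h2 h.1⟩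
    rw [C.remAll _ rfl hZ hg, Finset.filter_false_of_mem]
    · simpa using mem_atom_self y
    · intro q hq hp
      obtain ⟨r, hr, h1, h2⟩ := h q (hZ hq)
      have := (C.p1 q (hZ hq) hp).2.2.1 r hr h1
      subst this; exact h2 hq

end Cfg

lemma exists_cfg (hCG : CGp R) (hP : A.Pur) : ∃ (e : ℕ → R) (k : ℕ → ℕ) (b : ℕ → Ideal R) (y : R)
    (w : ℕ → R) (v : ℕ → Rˣ) (p : ℕ → Prop), Cfg A e k b y w v p ∧ ∀ q ∈ PP R, (q : R) * w q = 0 := by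
  classical
  obtain ⟨e, k, H⟩ := exists_QDs hCG
  have hb' : ∀ q, ∃ M, q ∈ PP R → A.MaxA M ∧ e q ∉ M := by
    intro q
    by_cases hq : q ∈ PP R
    · obtain ⟨M, hM⟩ := exists_max hCG hP hq (H q hq)
      exact ⟨M, fun _ => hM⟩
    · exact ⟨⊥, fun h => absurd h hq⟩
  choose b hb using hb'
  have ha' : ∀ q, ∃ a, q ∈ PP R → 1 ≤ a ∧ a ≤ k q ∧ (q : R) ^ a * e q ∈ b q ∧
      (q : R) ^ (a - 1) * e q ∉ b q := by
    intro q
    by_cases hq : q ∈ PP R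
    · have hex : ∃ a, (q : R) ^ a * e q ∈ b q := ⟨k q, by rw [(H q hq).kill]; exact (b q).zero_mem⟩
      have h1 := Nat.find_spec hex
      have h0 : 1 ≤ Nat.find hex := by
        by_contra hcon
        have : Nat.find hex = 0 := by omega
        rw [this] at h1
        simp only [pow_zero, one_mul] at h1
        exact (hb q hq).2 h1
      refine ⟨Nat.find hex, fun _ => ⟨h0, ?_, h1, Nat.find_min hex (by omega)⟩⟩
      exact Nat.find_min' hex (by rw [(H q hq).kill]; exact (b q).zero_mem)
    · exact ⟨0, fun h => absurd h hq⟩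
  choose a ha using ha'
  set y : R := ∑ q ∈ PP R, (q : R) ^ (a q - 1) * e q with hy
  have hey : ∀ q ∈ PP R, e q * y = (q : R) ^ (a q - 1) * e q := by
    intro q hq
    rw [hy, Finset.mul_sum, Finset.sum_eq_single q]
    · linear_combination (q : R) ^ (a q - 1) * (H q hq).idem
    · intro r hr hrq
      linear_combination (r : R) ^ (a r - 1) * orth H hq hr hrq.symm
    · intro h; exact absurd hq h
  have hny : ∀ q ∈ PP R, e q * y ∉ b q := by
    intro q hq
    rw [hey q hq]; exact (ha q hq).2.2.2
  have hgy : A.Gen y := (gen_iff H hb).mpr fun q hq => ⟨q, hq, rfl, hny q hq⟩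
  have hsing : ∀ q ∈ PP R, ¬ a q = k q → ∀ r ∈ PP R, b r = b q → r = q := by
    intro q hq hne r hr hbr
    by_contra hrq
    apply y_notMem hCG hP H hb hq hr hrq hbr
    obtain ⟨h1, h2, h3, -⟩ := ha q hq
    have : (q : R) ^ (k q - 1) * e q = (q : R) ^ (k q - 1 - a q) * ((q : R) ^ a q * e q) := by
      rw [← mul_assoc, ← pow_add]; congr 2; omega
    rw [this]; exact (b q).mul_mem_left _ h3
  have hv' : ∀ q, ∃ v : Rˣ, q ∈ PP R → ¬ a q = k q → ∃ t : R, (v : R) = 1 + q * e q * t ∧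
      (q : R) * (v * y - y) = 0 ∧ (v : R) * y ∉ A.atom y := by
    intro q
    by_cases hq : q ∈ PP R ∧ ¬ a q = k q
    · obtain ⟨h1, h2, h3, -⟩ := ha q hq.1
      obtain ⟨v, hv⟩ := exists_v hP H hb hq.1 (hsing q hq.1 hq.2) h1
        (lt_of_le_of_ne h2 hq.2) h3 hgy (hey q hq.1)
      exact ⟨v, fun _ _ => hv⟩
    · exact ⟨1, fun h h' => absurd ⟨h, h'⟩ hq⟩
  choose v hv using hv'
  have hw : ∀ q ∈ PP R, (q : R) * (if a q = k q then -((q : R) ^ (k q - 1) * e q) else v q * y - y) = 0 := by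
    intro q hq
    split_ifs with h
    · rw [mul_neg, (H q hq).y_kill, neg_zero]
    · obtain ⟨t, -, h2, -⟩ := hv q hq h
      exact h2
  refine ⟨e, k, b, y, fun q => if a q = k q then -((q : R) ^ (k q - 1) * e q) else v q * y - y, v,
    fun q => a q = k q, ⟨hCG, H, hb, hny, ?_, ?_, ?_⟩, hw⟩
  · intro q hq
    exact (H q hq).e_mul_of_kill (hw q hq)
  · intro q hq h
    refine ⟨by rw [hey q hq, h], by simp [h]⟩
  · intro q hq h
    obtain ⟨t, h1, h2, h3⟩ := hv q hq h
    refine ⟨by simp [h], h3, hsing q hq h, pow_one_of_nilp (H q hq) _ t h1, ?_⟩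
    rw [h1]; linear_combination (-(q : R) * t) * (H q hq).idem

lemma main (hCG : CGp R) (hP : A.Pur) (hbox : ∀ c, A.Gen c → ∀ w : ℕ → R,
    (∀ q ∈ PP R, (q : R) * w q = 0) → ∀ y, ∑ Z ∈ (PP R).powerset,
      (-1 : ℂ) ^ Z.card * ci (A.atom c) (y + ∑ q ∈ Z, w q) = 0) : False := by
  classical
  obtain ⟨e, k, b, y, w, v, p, C, hw⟩ := exists_cfg hCG hP
  refine alt_sum (PP R) b (fun Z => ci (A.atom y) (y + ∑ q ∈ Z, w q)) ?_ ?_ (hbox y C.gy w hw y)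
  · intro Z hZ h
    have := (C.corner_iff hZ).mpr h
    simp [ci, this]
  · intro Z hZ h
    have := mt (C.corner_iff hZ).mp h
    simp [ci, this]

end SA


/-- The dual of a pure S-ring over a CG-ring is pure: identifying the dual ring `R̂`
with `R` via a generating character `χ₀`, every class of the dual partition that
meets the units `R̂^×` has pure preimage in `R`. -/
theorem dual_of_pure_is_pure {R : Type*} [CommRing R] [Fintype R]
    (hCG : IsCGRing R) (A : AddSchurRing R) (hA : A.IsRingSRing)
    (hpure : ∀ Y ∈ A.parts, (∃ y ∈ Y, IsUnit y) → IsPureSet Y)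
    (χ₀ : AddChar R ℂ) (hχ₀ : Function.Bijective (fun r : R => χ₀.mulShift r)) :
    ∀ C ∈ addDualParts A.parts, (∃ u : Rˣ, χ₀.mulShift (u : R) ∈ C) →
      IsPureSet {r : R | χ₀.mulShift r ∈ C} := by
  classical
  have hC := CGp_of_isCG hCG
  have hprim := prim_of_bij hχ₀
  rintro C ⟨ψ₀, rfl⟩ ⟨u, hu⟩ I hXI
  by_contra hI
  simp only [Set.mem_ofPred_eq] at hu
  have hX : {r : R | χ₀.mulShift r ∈ {ψ : AddChar R ℂ | ∀ S ∈ A.parts,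
      (∑ᶠ s ∈ S, ψ s) = ∑ᶠ s ∈ S, ψ₀ s}} =
      {r : R | ∀ S ∈ A.parts, FT χ₀ (ci S) r = FT χ₀ (ci S) (u : R)} := by
    ext r
    simp only [Set.mem_ofPred_eq]
    refine forall₂_congr fun S hS => ?_
    rw [← hu S hS, finsum_FT, finsum_FT]
  simp only at hXI
  rw [hX] at hXI
  have hv := vanish A hA hprim u I hI (fun r hr i hi => by
    have := Set.add_mem_add hr (show i ∈ (I : Set R) from hi)
    rw [hXI] at this
    exact this)
  have hpart : ∀ c, (A.toSA hA).Gen c → (A.toSA hA).atom c ∈ A.parts ∧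
      ∃ s ∈ (A.toSA hA).atom c, IsUnit s := by
    intro c hc
    obtain ⟨t, ht⟩ := SA.gen_unit hC (A.toSA hA) hc
    exact ⟨by rw [A.atom_eq hA]; exact A.cls_mem c, t, ht, t.isUnit⟩
  refine SA.main (A := A.toSA hA) hC ?_ ?_
  · intro c hc q hq
    by_contra hcon
    push Not at hcon
    obtain ⟨h1, h2⟩ := hpart c hc
    obtain ⟨e, k, H⟩ := exists_QDs hC
    let J : Ideal R := LinearMap.ker (LinearMap.mulLeft R (q : R))
    have hJm : ∀ w, w ∈ J ↔ (q : R) * w = 0 := fun w => by simp [J]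
    have hJ : J = ⊥ := by
      apply hpure _ h1 h2
      apply Set.Subset.antisymm
      · rintro _ ⟨x, hx, w, hw, rfl⟩
        exact hcon x hx w ((hJm w).mp hw)
      · intro x hx
        exact ⟨x, hx, 0, J.zero_mem, add_zero x⟩
    have h3 := (hJm _).mpr (H q hq).y_kill
    rw [hJ] at h3
    exact (H q hq).ne (by simpa using h3)
  · intro c hc w hw y
    obtain ⟨h1, h2⟩ := hpart c hc
    exact box hC hprim _ (fun v => hv _ h1 h2 v) w hw y
end
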